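/- Every vector v ∈ ℝ^16 satisfying ⟨g, v⟩ ≥ 0 for all g ∈ Γ lies in cone(𝒜); that is, Γ^∨ ⊆ cone(𝒜). (This inclusion is the key computational step in the proof of the main theorem that the effective cone of M̄_{0,6} is generated by the 25 boundary divisors together with the 15 fixed-point divisors F_σ, σ a product of three disjoint transpositions.) -/

import Mathlib

noncomputable section

/-- Index in `Fin 16` of the exceptional class `E_{ab}` attached to a pair of points
(points written `0`-based as elements of `Fin 5`, assuming `a < b`):
`(0,1) ↦ 6, (0,2) ↦ 7, …, (3,4) ↦ 15`. -/
def pairIdx : ℕ → ℕ → Fin 16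
  | 0, 1 => 6
  | 0, 2 => 7
  | 0, 3 => 8
  | 0, 4 => 9
  | 1, 2 => 10
  | 1, 3 => 11
  | 1, 4 => 12
  | 2, 3 => 13
  | 2, 4 => 14
  | 3, 4 => 15
  | _, _ => 0

/-- The coordinate vector `e_L` (the class `L`). -/
def eL : Fin 16 → ℝ := Pi.single 0 1

/-- The coordinate vector `e_i` for the point `i ∈ {1,…,5}` (represented `0`-based
by `i : Fin 5`). -/
def eP (i : Fin 5) : Fin 16 → ℝ := Pi.single ⟨i.val + 1, by omega⟩ 1

/-- The coordinate vector `e_{ab}` for a 2-element subset `{a,b} ⊂ {1,…,5}`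
(represented `0`-based); symmetric in `a` and `b`. -/
def eE (a b : Fin 5) : Fin 16 → ℝ :=
  Pi.single (if a.val < b.val then pairIdx a.val b.val else pairIdx b.val a.val) 1

/-- The standard inner product on `ℝ¹⁶`. -/
def ip (x y : Fin 16 → ℝ) : ℝ := ∑ i, x i * y i

def Distinct3 (k l m : Fin 5) : Prop := k ≠ l ∧ k ≠ m ∧ l ≠ m

def Distinct5 (i j k l m : Fin 5) : Prop :=
  i ≠ j ∧ i ≠ k ∧ i ≠ l ∧ i ≠ m ∧ j ≠ k ∧ j ≠ l ∧ j ≠ m ∧ k ≠ l ∧ k ≠ m ∧ l ≠ m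

/-- The 40 classes: 25 boundary divisors and 15 fixed-point divisors `F_σ` of `M̄₀₆`. -/
def Gamma : Set (Fin 16 → ℝ) :=
  {v | (∃ i : Fin 5, v = eP i) ∨
       (∃ a b : Fin 5, a ≠ b ∧ v = eE a b) ∨
       (∃ k l m : Fin 5, Distinct3 k l m ∧
          v = eL - eP k - eP l - eP m - eE k l - eE k m - eE l m) ∨
       (∃ j a b c d : Fin 5, Distinct5 j a b c d ∧
          v = (2 : ℝ) • eL - (∑ i, eP i) - eE a c - eE a d - eE b c - eE b d)}

/-- The dual cone `Γ^∨ = {v : ⟨g,v⟩ ≥ 0 for all g ∈ Γ}`. -/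
def GammaDual : Set (Fin 16 → ℝ) := {v | ∀ gv ∈ Gamma, 0 ≤ ip gv v}
/-- `B_{ab6} = -e_{ab}` for a pair `{a,b} ⊂ {1,…,5}`. -/
def B6 (a b : Fin 5) : Fin 16 → ℝ := -(eE a b)

/-- `B_{ijk} = e_L + e_a + e_b - e_{ab}` for a 3-element `{i,j,k} ⊂ {1,…,5}`
with complement `{a,b}`. -/
def Bv (i j k a b : Fin 5) : Fin 16 → ℝ := eL + eP a + eP b - eE a b

/-- `A_{ij} = e_L + e_{ij} + e_{kl} + e_{km} + e_{lm}` for a pair `{i,j} ⊂ {1,…,5}`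
with complement `{k,l,m}`. -/
def A2 (i j k l m : Fin 5) : Fin 16 → ℝ := eL + eE i j + eE k l + eE k m + eE l m

/-- `A_{i6} = -2e_i + Σ_{j≠i} e_{ij}`. -/
def A6 (i : Fin 5) : Fin 16 → ℝ :=
  -((2 : ℝ) • eP i) + ∑ j, if j ≠ i then eE i j else 0

/-- `A_{ij;k} = e_L + e_k + e_{ab}` for distinct `i,j,k ∈ {1,…,5}`
with `{a,b}` the complement of `{i,j,k}`. -/
def A3 (i j k a b : Fin 5) : Fin 16 → ℝ := eL + eP k + eE a b

/-- `A_{ij;6} = 2e_L + e_k + e_l + e_m + e_{ij}` for a pair `{i,j} ⊂ {1,…,5}`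
with complement `{k,l,m}`. -/
def A36 (i j k l m : Fin 5) : Fin 16 → ℝ := (2 : ℝ) • eL + eP k + eP l + eP m + eE i j

/-- `A_{i6;k} = -e_i + e_{ik}` for distinct `i,k ∈ {1,…,5}`. -/
def A63 (i k : Fin 5) : Fin 16 → ℝ := -(eP i) + eE i k

/-- The set `𝒜` of 95 vectors: pushforwards of the generators of the nef curve cones
of the boundary divisors of `M̄₀₆`. -/
def Aset : Set (Fin 16 → ℝ) :=
  {v | (∃ a b, a ≠ b ∧ v = B6 a b) ∨
       (∃ i j k a b, Distinct5 i j k a b ∧ v = Bv i j k a b) ∨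
       (∃ i j k l m, Distinct5 i j k l m ∧ v = A2 i j k l m) ∨
       (∃ i, v = A6 i) ∨
       (∃ i j k a b, Distinct5 i j k a b ∧ v = A3 i j k a b) ∨
       (∃ i j k l m, Distinct5 i j k l m ∧ v = A36 i j k l m) ∨
       (∃ i k, i ≠ k ∧ v = A63 i k)}

/-- The convex cone generated by a set: all finite nonnegative combinations. -/
def coneGen (S : Set (Fin 16 → ℝ)) : Set (Fin 16 → ℝ) :=
  {v | ∃ (n : ℕ) (c : Fin n → ℝ) (x : Fin n → (Fin 16 → ℝ)),
      (∀ t, 0 ≤ c t) ∧ (∀ t, x t ∈ S) ∧ v = ∑ t, c t • x t}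
namespace EffectiveCone

/-- Coordinatewise inclusion of integer vectors into real vectors. -/
def toReal : (Fin 16 → ℤ) →+ (Fin 16 → ℝ) := (Int.castAddHom ℝ).compLeft (Fin 16)

lemma toReal_apply (a : Fin 16 → ℤ) (k : Fin 16) : toReal a k = (a k : ℝ) := rfl

/-- The integral coordinate vector with a `1` in position `k`. -/
def unit (k : Fin 16) : Fin 16 → ℤ := fun j => if j = k then 1 else 0

lemma toReal_unit (k : Fin 16) : toReal (unit k) = Pi.single k 1 := by
  ext j
  simp [toReal_apply, unit, Pi.single_apply]

/-- The integer vector with the given nonzero coordinates, listed together with their positions. -/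
def ofTerms (l : List (Fin 16 × ℤ)) : Fin 16 → ℤ := fun k =>
  (l.map fun (j, c) => if j = k then c else 0).sum

/-- The dot product with `ofTerms l`. -/
def pair (l : List (Fin 16 × ℤ)) (a : Fin 16 → ℤ) : ℤ := (l.map fun (j, c) => c * a j).sum

lemma ofTerms_dotProduct (l : List (Fin 16 × ℤ)) (a : Fin 16 → ℤ) :
    dotProduct (ofTerms l) a = pair l a := by
  induction l with
  | nil => simp [ofTerms, pair, dotProduct]
  | cons p l ih =>
    rw [dotProduct] at ih
    simp_all [ofTerms, pair, dotProduct, add_mul, Finset.sum_add_distrib]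

/-- The list of entries of an integer vector. -/
def entries (a : Fin 16 → ℤ) : List ℤ :=
  [a 0, a 1, a 2, a 3, a 4, a 5, a 6, a 7, a 8, a 9, a 10, a 11, a 12, a 13, a 14, a 15]

lemma entries_eq (a : Fin 16 → ℤ) : entries a = List.ofFn a := by
  simp [entries, List.ofFn_succ]

lemma entries_injective : Function.Injective entries := fun a b h =>
  List.ofFn_injective (by rwa [entries_eq, entries_eq] at h)

/-- The integer vector with the given list of entries. -/
def ofEntries (l : List ℤ) : Fin 16 → ℤ := fun k => l.getD k 0

lemma ofEntries_entries (a : Fin 16 → ℤ) : ofEntries (entries a) = a := by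
  ext k
  fin_cases k <;> rfl

instance : DecidableEq (Fin 16 → ℤ) := fun a b =>
  decidable_of_iff (entries a = entries b) entries_injective.eq_iff

/-! ### Integral versions of the vectors in the statement -/

/-- Integral version of `eL`. -/
def eLZ : Fin 16 → ℤ := unit 0

/-- Integral version of `eP`. -/
def ePZ (i : Fin 5) : Fin 16 → ℤ := unit ⟨i.val + 1, by omega⟩

/-- Integral version of `eE`. -/
def eEZ (a b : Fin 5) : Fin 16 → ℤ :=
  unit (if a.val < b.val then pairIdx a.val b.val else pairIdx b.val a.val)

lemma toReal_eLZ : toReal eLZ = eL := toReal_unit _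

lemma toReal_ePZ (i : Fin 5) : toReal (ePZ i) = eP i := toReal_unit _

lemma toReal_eEZ (a b : Fin 5) : toReal (eEZ a b) = eE a b := toReal_unit _

/-- Integral version of `B6`. -/
def B6Z (a b : Fin 5) : Fin 16 → ℤ := -(eEZ a b)

/-- Integral version of `Bv`. -/
def BvZ (a b : Fin 5) : Fin 16 → ℤ := eLZ + ePZ a + ePZ b - eEZ a b

/-- Integral version of `A2`. -/
def A2Z (i j k l m : Fin 5) : Fin 16 → ℤ := eLZ + eEZ i j + eEZ k l + eEZ k m + eEZ l m

/-- Integral version of `A6`. -/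
def A6Z (i : Fin 5) : Fin 16 → ℤ :=
  -(ePZ i + ePZ i) + ∑ j, if j ≠ i then eEZ i j else 0

/-- Integral version of `A3`. -/
def A3Z (k a b : Fin 5) : Fin 16 → ℤ := eLZ + ePZ k + eEZ a b

/-- Integral version of `A36`. -/
def A36Z (i j k l m : Fin 5) : Fin 16 → ℤ :=
  eLZ + eLZ + ePZ k + ePZ l + ePZ m + eEZ i j

/-- Integral version of `A63`. -/
def A63Z (i k : Fin 5) : Fin 16 → ℤ := -(ePZ i) + eEZ i k

lemma toReal_B6Z (a b : Fin 5) : toReal (B6Z a b) = B6 a b := by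
  simp [B6Z, B6, toReal_eEZ]

lemma toReal_BvZ (i j k a b : Fin 5) : toReal (BvZ a b) = Bv i j k a b := by
  simp [BvZ, Bv, toReal_eEZ, toReal_ePZ, toReal_eLZ]

lemma toReal_A2Z (i j k l m : Fin 5) : toReal (A2Z i j k l m) = A2 i j k l m := by
  simp [A2Z, A2, toReal_eEZ, toReal_eLZ]

lemma toReal_A6Z (i : Fin 5) : toReal (A6Z i) = A6 i := by
  simp only [A6Z, A6, map_add, map_neg, map_sum, apply_ite toReal, map_zero,
    toReal_eEZ, toReal_ePZ, two_smul]

lemma toReal_A3Z (i j k a b : Fin 5) : toReal (A3Z k a b) = A3 i j k a b := by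
  simp [A3Z, A3, toReal_eEZ, toReal_ePZ, toReal_eLZ]

lemma toReal_A36Z (i j k l m : Fin 5) : toReal (A36Z i j k l m) = A36 i j k l m := by
  simp only [A36Z, A36, map_add, toReal_eEZ, toReal_ePZ, toReal_eLZ,
    two_smul]

lemma toReal_A63Z (i k : Fin 5) : toReal (A63Z i k) = A63 i k := by
  simp [A63Z, A63, toReal_eEZ, toReal_ePZ]

instance (k l m : Fin 5) : Decidable (Distinct3 k l m) :=
  inferInstanceAs (Decidable (_ ∧ _))

instance (i j k l m : Fin 5) : Decidable (Distinct5 i j k l m) :=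
  inferInstanceAs (Decidable (_ ∧ _))

/-- The orderings `(i, j, k, l, m)` of the five points with `i < j` and `k < l < m`. -/
def splittings : List (Fin 5 × Fin 5 × Fin 5 × Fin 5 × Fin 5) :=
  [(0, 1, 2, 3, 4), (0, 2, 1, 3, 4), (0, 3, 1, 2, 4), (0, 4, 1, 2, 3), (1, 2, 0, 3, 4),
    (1, 3, 0, 2, 4), (1, 4, 0, 2, 3), (2, 3, 0, 1, 4), (2, 4, 0, 1, 3), (3, 4, 0, 1, 2)]

lemma distinct_of_mem_splittings :
    ∀ t ∈ splittings, Distinct5 t.1 t.2.1 t.2.2.1 t.2.2.2.1 t.2.2.2.2 := by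
  simp [splittings, Distinct5]

/-- The 95 elements of `Aset`, as integer vectors. -/
def curves : List (Fin 16 → ℤ) :=
  splittings.flatMap fun (i, j, k, l, m) =>
    [B6Z i j, BvZ i j, A2Z i j k l m, A36Z i j k l m, A3Z k i j, A3Z l i j, A3Z m i j,
      A63Z i j, A63Z j i] ++ if i = 0 ∧ j = 1 then [A6Z i, A6Z j, A6Z k, A6Z l, A6Z m] else []

lemma toReal_mem_Aset {a : Fin 16 → ℤ} (ha : a ∈ curves) : toReal a ∈ Aset := by
  obtain ⟨⟨i, j, k, l, m⟩, ht, ha⟩ := List.mem_flatMap.1 ha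
  obtain ⟨h1, h2, h3, h4, h5, h6, h7, h8, h9, h10⟩ := distinct_of_mem_splittings _ ht
  have hA6 (i : Fin 5) : toReal (A6Z i) ∈ Aset :=
    Or.inr (Or.inr (Or.inr (Or.inl ⟨i, toReal_A6Z i⟩)))
  have hA63 (i k : Fin 5) (h : i ≠ k) : toReal (A63Z i k) ∈ Aset :=
    Or.inr (Or.inr (Or.inr (Or.inr (Or.inr (Or.inr ⟨i, k, h, toReal_A63Z i k⟩)))))
  have hA3 (i j k a b : Fin 5) (h : Distinct5 i j k a b) : toReal (A3Z k a b) ∈ Aset :=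
    Or.inr (Or.inr (Or.inr (Or.inr (Or.inl ⟨i, j, k, a, b, h, toReal_A3Z i j k a b⟩))))
  simp only at ha h1 h2 h3 h4 h5 h6 h7 h8 h9 h10
  rcases List.mem_append.1 ha with ha | ha
  · simp only [List.mem_cons, List.not_mem_nil, or_false] at ha
    rcases ha with rfl | rfl | rfl | rfl | rfl | rfl | rfl | rfl | rfl
    · exact Or.inl ⟨i, j, h1, toReal_B6Z i j⟩
    · refine Or.inr (Or.inl ⟨k, l, m, i, j, ?_, toReal_BvZ k l m i j⟩)
      simp only [Distinct5]; tauto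
    · refine Or.inr (Or.inr (Or.inl ⟨i, j, k, l, m, ?_, toReal_A2Z i j k l m⟩))
      simp only [Distinct5]; tauto
    · refine Or.inr (Or.inr (Or.inr (Or.inr (Or.inr (Or.inl
        ⟨i, j, k, l, m, ?_, toReal_A36Z i j k l m⟩)))))
      simp only [Distinct5]; tauto
    · refine hA3 l m _ _ _ ?_
      simp only [Distinct5]; tauto
    · refine hA3 k m _ _ _ ?_
      simp only [Distinct5]; tauto
    · refine hA3 k l _ _ _ ?_
      simp only [Distinct5]; tauto
    · exact hA63 i j h1
    · exact hA63 j i h1.symm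
  · split_ifs at ha
    · simp only [List.mem_cons, List.not_mem_nil, or_false] at ha
      rcases ha with rfl | rfl | rfl | rfl | rfl <;> exact hA6 _
    · simp at ha

/-- The coordinates of the elements of `curves`, in the same order. -/
def curveRows : List (List ℤ) :=
  [[0, 0, 0, 0, 0, 0, -1, 0, 0, 0, 0, 0, 0, 0, 0, 0],
    [1, 1, 1, 0, 0, 0, -1, 0, 0, 0, 0, 0, 0, 0, 0, 0],
    [1, 0, 0, 0, 0, 0, 1, 0, 0, 0, 0, 0, 0, 1, 1, 1],
    [2, 0, 0, 1, 1, 1, 1, 0, 0, 0, 0, 0, 0, 0, 0, 0],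
    [1, 0, 0, 1, 0, 0, 1, 0, 0, 0, 0, 0, 0, 0, 0, 0],
    [1, 0, 0, 0, 1, 0, 1, 0, 0, 0, 0, 0, 0, 0, 0, 0],
    [1, 0, 0, 0, 0, 1, 1, 0, 0, 0, 0, 0, 0, 0, 0, 0],
    [0, -1, 0, 0, 0, 0, 1, 0, 0, 0, 0, 0, 0, 0, 0, 0],
    [0, 0, -1, 0, 0, 0, 1, 0, 0, 0, 0, 0, 0, 0, 0, 0],
    [0, -2, 0, 0, 0, 0, 1, 1, 1, 1, 0, 0, 0, 0, 0, 0],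
    [0, 0, -2, 0, 0, 0, 1, 0, 0, 0, 1, 1, 1, 0, 0, 0],
    [0, 0, 0, -2, 0, 0, 0, 1, 0, 0, 1, 0, 0, 1, 1, 0],
    [0, 0, 0, 0, -2, 0, 0, 0, 1, 0, 0, 1, 0, 1, 0, 1],
    [0, 0, 0, 0, 0, -2, 0, 0, 0, 1, 0, 0, 1, 0, 1, 1],
    [0, 0, 0, 0, 0, 0, 0, -1, 0, 0, 0, 0, 0, 0, 0, 0],
    [1, 1, 0, 1, 0, 0, 0, -1, 0, 0, 0, 0, 0, 0, 0, 0],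
    [1, 0, 0, 0, 0, 0, 0, 1, 0, 0, 0, 1, 1, 0, 0, 1],
    [2, 0, 1, 0, 1, 1, 0, 1, 0, 0, 0, 0, 0, 0, 0, 0],
    [1, 0, 1, 0, 0, 0, 0, 1, 0, 0, 0, 0, 0, 0, 0, 0],
    [1, 0, 0, 0, 1, 0, 0, 1, 0, 0, 0, 0, 0, 0, 0, 0],
    [1, 0, 0, 0, 0, 1, 0, 1, 0, 0, 0, 0, 0, 0, 0, 0],
    [0, -1, 0, 0, 0, 0, 0, 1, 0, 0, 0, 0, 0, 0, 0, 0],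
    [0, 0, 0, -1, 0, 0, 0, 1, 0, 0, 0, 0, 0, 0, 0, 0],
    [0, 0, 0, 0, 0, 0, 0, 0, -1, 0, 0, 0, 0, 0, 0, 0],
    [1, 1, 0, 0, 1, 0, 0, 0, -1, 0, 0, 0, 0, 0, 0, 0],
    [1, 0, 0, 0, 0, 0, 0, 0, 1, 0, 1, 0, 1, 0, 1, 0],
    [2, 0, 1, 1, 0, 1, 0, 0, 1, 0, 0, 0, 0, 0, 0, 0],
    [1, 0, 1, 0, 0, 0, 0, 0, 1, 0, 0, 0, 0, 0, 0, 0],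
    [1, 0, 0, 1, 0, 0, 0, 0, 1, 0, 0, 0, 0, 0, 0, 0],
    [1, 0, 0, 0, 0, 1, 0, 0, 1, 0, 0, 0, 0, 0, 0, 0],
    [0, -1, 0, 0, 0, 0, 0, 0, 1, 0, 0, 0, 0, 0, 0, 0],
    [0, 0, 0, 0, -1, 0, 0, 0, 1, 0, 0, 0, 0, 0, 0, 0],
    [0, 0, 0, 0, 0, 0, 0, 0, 0, -1, 0, 0, 0, 0, 0, 0],
    [1, 1, 0, 0, 0, 1, 0, 0, 0, -1, 0, 0, 0, 0, 0, 0],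
    [1, 0, 0, 0, 0, 0, 0, 0, 0, 1, 1, 1, 0, 1, 0, 0],
    [2, 0, 1, 1, 1, 0, 0, 0, 0, 1, 0, 0, 0, 0, 0, 0],
    [1, 0, 1, 0, 0, 0, 0, 0, 0, 1, 0, 0, 0, 0, 0, 0],
    [1, 0, 0, 1, 0, 0, 0, 0, 0, 1, 0, 0, 0, 0, 0, 0],
    [1, 0, 0, 0, 1, 0, 0, 0, 0, 1, 0, 0, 0, 0, 0, 0],
    [0, -1, 0, 0, 0, 0, 0, 0, 0, 1, 0, 0, 0, 0, 0, 0],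
    [0, 0, 0, 0, 0, -1, 0, 0, 0, 1, 0, 0, 0, 0, 0, 0],
    [0, 0, 0, 0, 0, 0, 0, 0, 0, 0, -1, 0, 0, 0, 0, 0],
    [1, 0, 1, 1, 0, 0, 0, 0, 0, 0, -1, 0, 0, 0, 0, 0],
    [1, 0, 0, 0, 0, 0, 0, 0, 1, 1, 1, 0, 0, 0, 0, 1],
    [2, 1, 0, 0, 1, 1, 0, 0, 0, 0, 1, 0, 0, 0, 0, 0],
    [1, 1, 0, 0, 0, 0, 0, 0, 0, 0, 1, 0, 0, 0, 0, 0],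
    [1, 0, 0, 0, 1, 0, 0, 0, 0, 0, 1, 0, 0, 0, 0, 0],
    [1, 0, 0, 0, 0, 1, 0, 0, 0, 0, 1, 0, 0, 0, 0, 0],
    [0, 0, -1, 0, 0, 0, 0, 0, 0, 0, 1, 0, 0, 0, 0, 0],
    [0, 0, 0, -1, 0, 0, 0, 0, 0, 0, 1, 0, 0, 0, 0, 0],
    [0, 0, 0, 0, 0, 0, 0, 0, 0, 0, 0, -1, 0, 0, 0, 0],
    [1, 0, 1, 0, 1, 0, 0, 0, 0, 0, 0, -1, 0, 0, 0, 0],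
    [1, 0, 0, 0, 0, 0, 0, 1, 0, 1, 0, 1, 0, 0, 1, 0],
    [2, 1, 0, 1, 0, 1, 0, 0, 0, 0, 0, 1, 0, 0, 0, 0],
    [1, 1, 0, 0, 0, 0, 0, 0, 0, 0, 0, 1, 0, 0, 0, 0],
    [1, 0, 0, 1, 0, 0, 0, 0, 0, 0, 0, 1, 0, 0, 0, 0],
    [1, 0, 0, 0, 0, 1, 0, 0, 0, 0, 0, 1, 0, 0, 0, 0],
    [0, 0, -1, 0, 0, 0, 0, 0, 0, 0, 0, 1, 0, 0, 0, 0],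
    [0, 0, 0, 0, -1, 0, 0, 0, 0, 0, 0, 1, 0, 0, 0, 0],
    [0, 0, 0, 0, 0, 0, 0, 0, 0, 0, 0, 0, -1, 0, 0, 0],
    [1, 0, 1, 0, 0, 1, 0, 0, 0, 0, 0, 0, -1, 0, 0, 0],
    [1, 0, 0, 0, 0, 0, 0, 1, 1, 0, 0, 0, 1, 1, 0, 0],
    [2, 1, 0, 1, 1, 0, 0, 0, 0, 0, 0, 0, 1, 0, 0, 0],
    [1, 1, 0, 0, 0, 0, 0, 0, 0, 0, 0, 0, 1, 0, 0, 0],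
    [1, 0, 0, 1, 0, 0, 0, 0, 0, 0, 0, 0, 1, 0, 0, 0],
    [1, 0, 0, 0, 1, 0, 0, 0, 0, 0, 0, 0, 1, 0, 0, 0],
    [0, 0, -1, 0, 0, 0, 0, 0, 0, 0, 0, 0, 1, 0, 0, 0],
    [0, 0, 0, 0, 0, -1, 0, 0, 0, 0, 0, 0, 1, 0, 0, 0],
    [0, 0, 0, 0, 0, 0, 0, 0, 0, 0, 0, 0, 0, -1, 0, 0],
    [1, 0, 0, 1, 1, 0, 0, 0, 0, 0, 0, 0, 0, -1, 0, 0],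
    [1, 0, 0, 0, 0, 0, 1, 0, 0, 1, 0, 0, 1, 1, 0, 0],
    [2, 1, 1, 0, 0, 1, 0, 0, 0, 0, 0, 0, 0, 1, 0, 0],
    [1, 1, 0, 0, 0, 0, 0, 0, 0, 0, 0, 0, 0, 1, 0, 0],
    [1, 0, 1, 0, 0, 0, 0, 0, 0, 0, 0, 0, 0, 1, 0, 0],
    [1, 0, 0, 0, 0, 1, 0, 0, 0, 0, 0, 0, 0, 1, 0, 0],
    [0, 0, 0, -1, 0, 0, 0, 0, 0, 0, 0, 0, 0, 1, 0, 0],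
    [0, 0, 0, 0, -1, 0, 0, 0, 0, 0, 0, 0, 0, 1, 0, 0],
    [0, 0, 0, 0, 0, 0, 0, 0, 0, 0, 0, 0, 0, 0, -1, 0],
    [1, 0, 0, 1, 0, 1, 0, 0, 0, 0, 0, 0, 0, 0, -1, 0],
    [1, 0, 0, 0, 0, 0, 1, 0, 1, 0, 0, 1, 0, 0, 1, 0],
    [2, 1, 1, 0, 1, 0, 0, 0, 0, 0, 0, 0, 0, 0, 1, 0],
    [1, 1, 0, 0, 0, 0, 0, 0, 0, 0, 0, 0, 0, 0, 1, 0],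
    [1, 0, 1, 0, 0, 0, 0, 0, 0, 0, 0, 0, 0, 0, 1, 0],
    [1, 0, 0, 0, 1, 0, 0, 0, 0, 0, 0, 0, 0, 0, 1, 0],
    [0, 0, 0, -1, 0, 0, 0, 0, 0, 0, 0, 0, 0, 0, 1, 0],
    [0, 0, 0, 0, 0, -1, 0, 0, 0, 0, 0, 0, 0, 0, 1, 0],
    [0, 0, 0, 0, 0, 0, 0, 0, 0, 0, 0, 0, 0, 0, 0, -1],
    [1, 0, 0, 0, 1, 1, 0, 0, 0, 0, 0, 0, 0, 0, 0, -1],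
    [1, 0, 0, 0, 0, 0, 1, 1, 0, 0, 1, 0, 0, 0, 0, 1],
    [2, 1, 1, 1, 0, 0, 0, 0, 0, 0, 0, 0, 0, 0, 0, 1],
    [1, 1, 0, 0, 0, 0, 0, 0, 0, 0, 0, 0, 0, 0, 0, 1],
    [1, 0, 1, 0, 0, 0, 0, 0, 0, 0, 0, 0, 0, 0, 0, 1],
    [1, 0, 0, 1, 0, 0, 0, 0, 0, 0, 0, 0, 0, 0, 0, 1],
    [0, 0, 0, 0, -1, 0, 0, 0, 0, 0, 0, 0, 0, 0, 0, 1],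
    [0, 0, 0, 0, 0, -1, 0, 0, 0, 0, 0, 0, 0, 0, 0, 1]]

lemma map_entries_curves : curves.map entries = curveRows := by decide +kernel

lemma mem_curves_iff {a : Fin 16 → ℤ} : a ∈ curves ↔ entries a ∈ curveRows := by
  rw [← map_entries_curves, List.mem_map_of_injective entries_injective]

lemma B6Z_mem : ∀ a b, a ≠ b → B6Z a b ∈ curves := by
  simp only [mem_curves_iff]
  decide +kernel

lemma BvZ_mem : ∀ a b, a ≠ b → BvZ a b ∈ curves := by
  simp only [mem_curves_iff]
  decide +kernel

lemma A2Z_mem : ∀ i j k l m, Distinct5 i j k l m → A2Z i j k l m ∈ curves := by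
  simp only [mem_curves_iff]
  decide +kernel

lemma A6Z_mem : ∀ i, A6Z i ∈ curves := by
  simp only [mem_curves_iff]
  decide +kernel

lemma A3Z_mem : ∀ k a b, Distinct3 k a b → A3Z k a b ∈ curves := by
  simp only [mem_curves_iff]
  decide +kernel

lemma A36Z_mem : ∀ i j k l m, Distinct5 i j k l m → A36Z i j k l m ∈ curves := by
  simp only [mem_curves_iff]
  decide +kernel

lemma A63Z_mem : ∀ i k, i ≠ k → A63Z i k ∈ curves := by
  simp only [mem_curves_iff]
  decide +kernel

lemma exists_toReal_of_mem_Aset {x : Fin 16 → ℝ} (hx : x ∈ Aset) :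
    ∃ a ∈ curves, toReal a = x := by
  rcases hx with ⟨a, b, h, rfl⟩ | ⟨i, j, k, a, b, h, rfl⟩ | ⟨i, j, k, l, m, h, rfl⟩ | ⟨i, rfl⟩ |
    ⟨i, j, k, a, b, h, rfl⟩ | ⟨i, j, k, l, m, h, rfl⟩ | ⟨i, k, h, rfl⟩
  · exact ⟨_, B6Z_mem a b h, toReal_B6Z a b⟩
  · exact ⟨_, BvZ_mem a b (by simp only [Distinct5] at h; tauto), toReal_BvZ i j k a b⟩
  · exact ⟨_, A2Z_mem i j k l m h, toReal_A2Z i j k l m⟩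
  · exact ⟨_, A6Z_mem i, toReal_A6Z i⟩
  · exact ⟨_, A3Z_mem k a b (by simp only [Distinct5] at h; simp only [Distinct3]; tauto),
      toReal_A3Z i j k a b⟩
  · exact ⟨_, A36Z_mem i j k l m h, toReal_A36Z i j k l m⟩
  · exact ⟨_, A63Z_mem i k h, toReal_A63Z i k⟩

lemma finite_Aset : Aset.Finite :=
  ((List.finite_toSet curves).image toReal).subset fun _ hx => exists_toReal_of_mem_Aset hx

/-- The nonzero coordinates of the 40 elements of `Gamma`: the five `e_i`, the ten `e_{ab}`, the ten
classes attached to triples and the fifteen fixed-point divisors, each block in lexicographic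
order. -/
def divisorRows : List (List (Fin 16 × ℤ)) :=
  [[(1, 1)], [(2, 1)], [(3, 1)], [(4, 1)], [(5, 1)], [(6, 1)], [(7, 1)], [(8, 1)], [(9, 1)],
    [(10, 1)], [(11, 1)], [(12, 1)], [(13, 1)], [(14, 1)], [(15, 1)],
    [(0, 1), (1, -1), (2, -1), (3, -1), (6, -1), (7, -1), (10, -1)],
    [(0, 1), (1, -1), (2, -1), (4, -1), (6, -1), (8, -1), (11, -1)],
    [(0, 1), (1, -1), (2, -1), (5, -1), (6, -1), (9, -1), (12, -1)],
    [(0, 1), (1, -1), (3, -1), (4, -1), (7, -1), (8, -1), (13, -1)],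
    [(0, 1), (1, -1), (3, -1), (5, -1), (7, -1), (9, -1), (14, -1)],
    [(0, 1), (1, -1), (4, -1), (5, -1), (8, -1), (9, -1), (15, -1)],
    [(0, 1), (2, -1), (3, -1), (4, -1), (10, -1), (11, -1), (13, -1)],
    [(0, 1), (2, -1), (3, -1), (5, -1), (10, -1), (12, -1), (14, -1)],
    [(0, 1), (2, -1), (4, -1), (5, -1), (11, -1), (12, -1), (15, -1)],
    [(0, 1), (3, -1), (4, -1), (5, -1), (13, -1), (14, -1), (15, -1)],
    [(0, 2), (1, -1), (2, -1), (3, -1), (4, -1), (5, -1), (11, -1), (12, -1), (13, -1),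
      (14, -1)],
    [(0, 2), (1, -1), (2, -1), (3, -1), (4, -1), (5, -1), (10, -1), (12, -1), (13, -1),
      (15, -1)],
    [(0, 2), (1, -1), (2, -1), (3, -1), (4, -1), (5, -1), (10, -1), (11, -1), (14, -1),
      (15, -1)],
    [(0, 2), (1, -1), (2, -1), (3, -1), (4, -1), (5, -1), (8, -1), (9, -1), (13, -1), (14, -1)],
    [(0, 2), (1, -1), (2, -1), (3, -1), (4, -1), (5, -1), (7, -1), (9, -1), (13, -1), (15, -1)],
    [(0, 2), (1, -1), (2, -1), (3, -1), (4, -1), (5, -1), (7, -1), (8, -1), (14, -1), (15, -1)],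
    [(0, 2), (1, -1), (2, -1), (3, -1), (4, -1), (5, -1), (8, -1), (9, -1), (11, -1), (12, -1)],
    [(0, 2), (1, -1), (2, -1), (3, -1), (4, -1), (5, -1), (6, -1), (9, -1), (11, -1), (15, -1)],
    [(0, 2), (1, -1), (2, -1), (3, -1), (4, -1), (5, -1), (6, -1), (8, -1), (12, -1), (15, -1)],
    [(0, 2), (1, -1), (2, -1), (3, -1), (4, -1), (5, -1), (7, -1), (9, -1), (10, -1), (12, -1)],
    [(0, 2), (1, -1), (2, -1), (3, -1), (4, -1), (5, -1), (6, -1), (9, -1), (10, -1), (14, -1)],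
    [(0, 2), (1, -1), (2, -1), (3, -1), (4, -1), (5, -1), (6, -1), (7, -1), (12, -1), (14, -1)],
    [(0, 2), (1, -1), (2, -1), (3, -1), (4, -1), (5, -1), (7, -1), (8, -1), (10, -1), (11, -1)],
    [(0, 2), (1, -1), (2, -1), (3, -1), (4, -1), (5, -1), (6, -1), (8, -1), (10, -1), (13, -1)],
    [(0, 2), (1, -1), (2, -1), (3, -1), (4, -1), (5, -1), (6, -1), (7, -1), (11, -1), (13, -1)]]

/-- The nonzero coordinates of an element of `Gamma`. -/
def divisorTerms (r : Fin 40) : List (Fin 16 × ℤ) := divisorRows.getD r []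

/-- The 40 elements of `Gamma`, as the rows of an integer matrix. -/
def divisors : Matrix (Fin 40) (Fin 16) ℤ := fun r => ofTerms (divisorTerms r)

/-- Integral version of the boundary divisor attached to a triple. -/
def tripleZ (k l m : Fin 5) : Fin 16 → ℤ :=
  eLZ - ePZ k - ePZ l - ePZ m - eEZ k l - eEZ k m - eEZ l m

/-- Integral version of the fixed-point divisor attached to two disjoint pairs. -/
def fixedPointZ (a b c d : Fin 5) : Fin 16 → ℤ :=
  eLZ + eLZ - (∑ i, ePZ i) - eEZ a c - eEZ a d - eEZ b c - eEZ b d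

/-- The elements of `Gamma`, the fixed-point divisors occurring twice, as integer vectors. -/
def divisorList : List (Fin 16 → ℤ) :=
  (List.finRange 5).map ePZ ++ splittings.flatMap fun (i, j, k, l, m) =>
    [eEZ i j, tripleZ k l m, fixedPointZ i j k l, fixedPointZ i j k m, fixedPointZ i j l m]

lemma divisors_mem (r : Fin 40) : divisors r ∈ divisorList := by
  rw [← List.mem_map_of_injective entries_injective]
  revert r
  decide +kernel

lemma toReal_divisors_mem (r : Fin 40) : toReal (divisors r) ∈ Gamma := by
  have hfixed (j a b c d : Fin 5) (h : Distinct5 j a b c d) :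
      toReal (fixedPointZ a b c d) ∈ Gamma := by
    refine Or.inr (Or.inr (Or.inr ⟨j, a, b, c, d, h, ?_⟩))
    simp only [fixedPointZ, map_sub, map_add, map_sum, toReal_eLZ, toReal_ePZ, toReal_eEZ,
      two_smul]
  rcases List.mem_append.1 (divisors_mem r) with h | h
  · obtain ⟨i, -, h⟩ := List.mem_map.1 h
    exact Or.inl ⟨i, by rw [← h, toReal_ePZ]⟩
  · obtain ⟨⟨i, j, k, l, m⟩, ht, h⟩ := List.mem_flatMap.1 h
    have hd := distinct_of_mem_splittings _ ht
    simp only [List.mem_cons, List.not_mem_nil, or_false, Distinct5] at h hd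
    rcases h with h | h | h | h | h <;> rw [h]
    · exact Or.inr (Or.inl ⟨i, j, hd.1, toReal_eEZ i j⟩)
    · refine Or.inr (Or.inr (Or.inl ⟨k, l, m, ?_, ?_⟩))
      · simp only [Distinct3]; tauto
      · simp only [tripleZ, map_sub, toReal_eLZ, toReal_ePZ, toReal_eEZ]
    · refine hfixed m _ _ _ _ ?_
      simp only [Distinct5]; tauto
    · refine hfixed l _ _ _ _ ?_
      simp only [Distinct5]; tauto
    · refine hfixed k _ _ _ _ ?_
      simp only [Distinct5]; tauto

/-- The images of the rows of `divisors` under the adjacent transpositions `(s, s + 1)` of the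
six marked points. -/
def swapRows : List (List ℕ) :=
  [[1, 0, 2, 3, 4, 5, 9, 10, 11, 6, 7, 8, 12, 13, 14, 15, 16, 17, 21, 22, 23, 18, 19, 20, 24,
    28, 29, 30, 25, 26, 27, 31, 33, 32, 34, 36, 35, 37, 39, 38], [0, 2, 1, 3, 4, 6, 5, 7, 8, 9,
    12, 13, 10, 11, 14, 15, 18, 19, 16, 17, 20, 21, 22, 24, 23, 25, 27, 26, 31, 32, 33, 28, 29,
    30, 35, 34, 36, 38, 37, 39], [0, 1, 3, 2, 4, 5, 7, 6, 8, 10, 9, 11, 12, 14, 13, 16, 15, 17,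
    18, 20, 19, 21, 23, 22, 24, 26, 25, 27, 29, 28, 30, 34, 35, 36, 31, 32, 33, 37, 39, 38], [0,
    1, 2, 4, 3, 5, 6, 8, 7, 9, 11, 10, 13, 12, 14, 15, 17, 16, 19, 18, 20, 22, 21, 23, 24, 25, 27,
    26, 28, 30, 29, 31, 33, 32, 37, 38, 39, 34, 35, 36], [21, 18, 16, 15, 4, 12, 10, 9, 8, 7, 6,
    11, 5, 13, 14, 3, 2, 17, 1, 19, 20, 0, 22, 23, 24, 36, 33, 30, 35, 32, 27, 34, 29, 26, 31, 28,
    25, 37, 38, 39]]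

/-- The action of the adjacent transposition `(s, s + 1)` of the six marked points on the rows
of `divisors`. -/
def swapDivisor (s : Fin 5) (r : Fin 40) : Fin 40 :=
  Fin.ofNat 40 ((swapRows.getD s []).getD r 0)

/-- The nonzero coordinates of the rows of `swapMatrix s`. -/
def swapTerms (s : Fin 5) : Fin 16 → List (Fin 16 × ℤ)
  | ⟨0, _⟩ => [15, 0, 1, 2, 5, 6, 9].flatMap fun r => divisorTerms (swapDivisor s r)
  | ⟨k + 1, hk⟩ => divisorTerms (swapDivisor s ⟨k, by omega⟩)

/-- The matrix by which the adjacent transposition `(s, s + 1)` of the six marked points acts on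
curve classes; for `s = 4` this is a standard Cremona transformation. -/
def swapMatrix (s : Fin 5) : Matrix (Fin 16) (Fin 16) ℤ := fun k => ofTerms (swapTerms s k)

lemma pair_divisorTerms_swapMatrix : ∀ s r k,
    pair (divisorTerms r) (fun j => swapMatrix s j k) = divisors (swapDivisor s r) k := by
  decide +kernel

lemma divisors_mul_swapMatrix (s : Fin 5) :
    divisors * swapMatrix s = divisors.submatrix (swapDivisor s) id := by
  ext r k
  rw [Matrix.mul_apply']
  exact (ofTerms_dotProduct _ _).trans (pair_divisorTerms_swapMatrix s r k)

lemma pair_swapTerms_swapMatrix : ∀ s i k,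
    pair (swapTerms s i) (fun j => swapMatrix s j k) = if i = k then 1 else 0 := by
  decide +kernel

lemma swapMatrix_mul_self (s : Fin 5) : swapMatrix s * swapMatrix s = 1 := by
  ext i k
  rw [Matrix.mul_apply', Matrix.one_apply]
  exact (ofTerms_dotProduct _ _).trans (pair_swapTerms_swapMatrix s i k)

lemma pair_swapTerms_mem : ∀ s, ∀ l ∈ curveRows,
    entries (fun k => pair (swapTerms s k) (ofEntries l)) ∈ curveRows := by
  decide +kernel

lemma swapMatrix_mulVec_mem (s : Fin 5) {a : Fin 16 → ℤ} (ha : a ∈ curves) :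
    (swapMatrix s).mulVec a ∈ curves := by
  rw [mem_curves_iff] at ha ⊢
  convert pair_swapTerms_mem s _ ha using 2
  ext k
  rw [ofEntries_entries, ← ofTerms_dotProduct]
  rfl

/-! ### The cone generated by `Aset` -/

lemma mem_coneGen_of_mem {S : Set (Fin 16 → ℝ)} {x : Fin 16 → ℝ} (hx : x ∈ S) :
    x ∈ coneGen S :=
  ⟨1, fun _ => 1, fun _ => x, fun _ => zero_le_one, fun _ => hx, by simp⟩

lemma zero_mem_coneGen (S : Set (Fin 16 → ℝ)) : 0 ∈ coneGen S :=
  ⟨0, Fin.elim0, Fin.elim0, fun t => t.elim0, fun t => t.elim0, by simp⟩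

lemma add_mem_coneGen {S : Set (Fin 16 → ℝ)} {x y : Fin 16 → ℝ} (hx : x ∈ coneGen S)
    (hy : y ∈ coneGen S) : x + y ∈ coneGen S := by
  obtain ⟨n, c, u, hc, hu, rfl⟩ := hx
  obtain ⟨m, d, w, hd, hw, rfl⟩ := hy
  refine ⟨n + m, Fin.append c d, Fin.append u w, ?_, ?_, ?_⟩
  · exact fun t => Fin.addCases (by simpa using hc) (by simpa using hd) t
  · exact fun t => Fin.addCases (by simpa using hu) (by simpa using hw) t
  · simp [Fin.sum_univ_add]

lemma smul_mem_coneGen {S : Set (Fin 16 → ℝ)} {x : Fin 16 → ℝ} {r : ℝ} (hr : 0 ≤ r)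
    (hx : x ∈ coneGen S) : r • x ∈ coneGen S := by
  obtain ⟨n, c, u, hc, hu, rfl⟩ := hx
  exact ⟨n, fun t => r * c t, u, fun t => mul_nonneg hr (hc t), hu, by
    simp [Finset.smul_sum, mul_smul]⟩

lemma sum_mem_coneGen {S : Set (Fin 16 → ℝ)} {ι : Type*} (s : Finset ι) {f : ι → Fin 16 → ℝ}
    (h : ∀ i ∈ s, f i ∈ coneGen S) : ∑ i ∈ s, f i ∈ coneGen S :=
  Finset.sum_induction f (· ∈ coneGen S) (fun _ _ => add_mem_coneGen) (zero_mem_coneGen S) h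

lemma map_mem_coneGen {S T : Set (Fin 16 → ℝ)} (f : (Fin 16 → ℝ) →ₗ[ℝ] (Fin 16 → ℝ))
    (hf : ∀ x ∈ S, f x ∈ T) {x : Fin 16 → ℝ} (hx : x ∈ coneGen S) : f x ∈ coneGen T := by
  obtain ⟨n, c, u, hc, hu, rfl⟩ := hx
  exact ⟨n, c, fun t => f (u t), hc, fun t => hf _ (hu t), by simp⟩

lemma exists_linearCombination_eq {S : Set (Fin 16 → ℝ)} [Fintype S] {x : Fin 16 → ℝ}
    (hx : x ∈ coneGen S) :
    ∃ c : S → ℝ, 0 ≤ c ∧ Fintype.linearCombination ℝ ((↑) : S → Fin 16 → ℝ) c = x := by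
  classical
  obtain ⟨n, c, u, hc, hu, rfl⟩ := hx
  refine ⟨∑ t, c t • Pi.single ⟨u t, hu t⟩ 1,
    Finset.sum_nonneg fun t _ => smul_nonneg (hc t) (Pi.single_nonneg.2 zero_le_one), ?_⟩
  simp

lemma linearCombination_mem_coneGen {S : Set (Fin 16 → ℝ)} [Fintype S] {c : S → ℝ}
    (hc : 0 ≤ c) : Fintype.linearCombination ℝ ((↑) : S → Fin 16 → ℝ) c ∈ coneGen S := by
  rw [Fintype.linearCombination_apply]
  exact sum_mem_coneGen _ fun i _ => smul_mem_coneGen (hc i) (mem_coneGen_of_mem i.2)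

/-! ### Degrees of curve classes on the divisors -/

/-- The degrees of a curve class on the 40 divisors. -/
def degrees : (Fin 16 → ℝ) →ₗ[ℝ] (Fin 40 → ℝ) := (divisors.map (Int.cast : ℤ → ℝ)).mulVecLin

lemma degrees_apply (v : Fin 16 → ℝ) (r : Fin 40) :
    degrees v r = ∑ k, (divisors r k : ℝ) * v k := rfl

lemma degrees_toReal (a : Fin 16 → ℤ) (r : Fin 40) :
    degrees (toReal a) r = (pair (divisorTerms r) a : ℝ) := by
  rw [← ofTerms_dotProduct, degrees_apply, dotProduct, Int.cast_sum]
  simp [toReal_apply, divisors]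

/-- The action of the adjacent transposition `(s, s + 1)` on curve classes. -/
def swap (s : Fin 5) : (Fin 16 → ℝ) →ₗ[ℝ] (Fin 16 → ℝ) :=
  ((swapMatrix s).map (Int.cast : ℤ → ℝ)).mulVecLin

lemma swap_swap (s : Fin 5) (v : Fin 16 → ℝ) : swap s (swap s v) = v := by
  have h : (swapMatrix s).map (Int.cast : ℤ → ℝ) * (swapMatrix s).map Int.cast = 1 := by
    rw [← Matrix.map_mul_intCast, swapMatrix_mul_self,
      Matrix.map_one _ Int.cast_zero Int.cast_one]
  simp only [swap, Matrix.mulVecLin_apply, Matrix.mulVec_mulVec, h, Matrix.one_mulVec]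

lemma degrees_swap (s : Fin 5) (v : Fin 16 → ℝ) (r : Fin 40) :
    degrees (swap s v) r = degrees v (swapDivisor s r) := by
  have h : divisors.map (Int.cast : ℤ → ℝ) * (swapMatrix s).map (Int.cast : ℤ → ℝ) =
      (divisors.submatrix (swapDivisor s) id).map Int.cast :=
    (Matrix.map_mul (f := Int.castRingHom ℝ)).symm.trans
      (congrArg (Matrix.map · Int.cast) (divisors_mul_swapMatrix s))
  simp only [degrees, swap, Matrix.mulVecLin_apply, Matrix.mulVec_mulVec, h]
  rfl

lemma swap_mem_Aset (s : Fin 5) {x : Fin 16 → ℝ} (hx : x ∈ Aset) : swap s x ∈ Aset := by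
  obtain ⟨a, ha, rfl⟩ := exists_toReal_of_mem_Aset hx
  convert toReal_mem_Aset (swapMatrix_mulVec_mem s ha) using 1
  ext k
  simp [swap, toReal_apply, Matrix.mulVec, dotProduct]

/-- A curve class is reduced if it has nonnegative degree on every divisor and this fails after
subtracting any nonzero element of the cone generated by `Aset`. -/
def IsReduced (v : Fin 16 → ℝ) : Prop :=
  0 ≤ degrees v ∧ ∀ a ∈ coneGen Aset, 0 ≤ degrees (v - a) → a = 0

lemma IsReduced.swap {v : Fin 16 → ℝ} (hv : IsReduced v) (s : Fin 5) :
    IsReduced (swap s v) := by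
  refine ⟨fun r => by rw [degrees_swap]; exact hv.1 (swapDivisor s r), fun a ha h => ?_⟩
  have h0 := hv.2 (EffectiveCone.swap s a)
    (map_mem_coneGen _ (fun _ => swap_mem_Aset s) ha) fun r => by
      rw [← swap_swap s v, ← map_sub, degrees_swap]
      exact h (swapDivisor s r)
  rw [← swap_swap s a, h0, map_zero]

lemma one_le_sum_degrees : ∀ l ∈ curveRows,
    1 ≤ (([25, 26, 27, 28, 29, 30, 31, 32, 33, 34, 35, 36, 37, 38, 39] : List (Fin 40)).map
      fun r => pair (divisorTerms r) (ofEntries l)).sum := by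
  decide +kernel

/-- Every class with nonnegative degrees becomes reduced after subtracting some element of the
cone generated by `Aset`. -/
lemma exists_isReduced {v : Fin 16 → ℝ} (hv : 0 ≤ degrees v) :
    ∃ a ∈ coneGen Aset, IsReduced (v - a) := by
  classical
  have : Fintype Aset := finite_Aset.fintype
  set comb := Fintype.linearCombination ℝ ((↑) : Aset → Fin 16 → ℝ) with hcomb
  obtain ⟨height, hheight, hA⟩ : ∃ h : (Fin 16 → ℝ) →ₗ[ℝ] ℝ,
      (∀ u, 0 ≤ degrees u → 0 ≤ h u) ∧ ∀ x ∈ Aset, 1 ≤ h x := by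
    let l : List (Fin 40) := [25, 26, 27, 28, 29, 30, 31, 32, 33, 34, 35, 36, 37, 38, 39]
    have happ (u) : ((l.map fun r => LinearMap.proj r ∘ₗ degrees).sum) u =
        (l.map (degrees u)).sum := by simp [l]
    refine ⟨(l.map fun r => LinearMap.proj r ∘ₗ degrees).sum, fun u hu => ?_, fun x hx => ?_⟩
    · rw [happ]
      refine List.sum_nonneg fun y hy => ?_
      obtain ⟨r, -, rfl⟩ := List.mem_map.1 hy
      exact hu r
    · obtain ⟨a, ha, rfl⟩ := exists_toReal_of_mem_Aset hx
      rw [happ]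
      have := one_le_sum_degrees _ (mem_curves_iff.1 ha)
      rw [ofEntries_entries, ← Int.cast_le (R := ℝ)] at this
      simpa [l, degrees_toReal] using this
  have hcont : Continuous fun c => degrees (v - comb c) :=
    degrees.continuous_of_finiteDimensional.comp
      (continuous_const.sub comb.continuous_of_finiteDimensional)
  let C : Set (Aset → ℝ) := {c | 0 ≤ c ∧ 0 ≤ degrees (v - comb c)}
  have hle {c : Aset → ℝ} (hc : c ∈ C) : ∑ x, c x ≤ height v := by
    have h1 := hheight _ hc.2
    rw [map_sub, hcomb, Fintype.linearCombination_apply, map_sum] at h1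
    refine le_trans (Finset.sum_le_sum fun x _ => ?_) (sub_nonneg.1 h1)
    rw [map_smul, smul_eq_mul]
    exact le_mul_of_one_le_right (hc.1 x) (hA _ x.2)
  have hC : IsCompact C := by
    refine (isCompact_Icc (a := 0) (b := fun _ => height v)).of_isClosed_subset
      ((isClosed_le continuous_const continuous_id).inter
        (isClosed_le continuous_const hcont)) fun c hc => ⟨hc.1, fun x => ?_⟩
    exact (Finset.single_le_sum (fun y _ => hc.1 y) (Finset.mem_univ x)).trans (hle hc)
  obtain ⟨c, hc, hmax⟩ := hC.exists_isMaxOn ⟨0, le_rfl, by simpa using hv⟩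
    (f := fun c => ∑ x, c x) (by fun_prop)
  refine ⟨comb c, linearCombination_mem_coneGen hc.1, hc.2, fun a ha h => ?_⟩
  obtain ⟨d, hd, rfl⟩ := exists_linearCombination_eq ha
  have hsum : ∑ x, d x ≤ 0 := by
    have := isMaxOn_iff.1 hmax (c + d) ⟨add_nonneg hc.1 hd, by rwa [map_add, ← sub_sub]⟩
    simpa [Finset.sum_add_distrib] using this
  have h0 : d = 0 := by
    ext x
    exact (Finset.sum_eq_zero_iff_of_nonneg fun y _ => hd y).1
      (le_antisymm hsum (Finset.sum_nonneg fun y _ => hd y)) x (Finset.mem_univ x)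
  rw [h0, map_zero]

lemma IsReduced.exists_degrees_eq_zero {v a : Fin 16 → ℝ} (hv : IsReduced v)
    (ha : a ∈ coneGen Aset) (ha0 : a ≠ 0) : ∃ r, degrees v r = 0 ∧ 0 < degrees a r := by
  by_contra! hne
  have hev : ∀ᶠ ε : ℝ in nhdsWithin 0 (Set.Ioi 0), ∀ r, 0 ≤ degrees (v - ε • a) r := by
    refine Filter.eventually_all.2 fun r => ?_
    simp only [map_sub, map_smul, Pi.sub_apply, Pi.smul_apply, smul_eq_mul]
    rcases (hv.1 r).eq_or_lt with h | h
    · filter_upwards [self_mem_nhdsWithin] with ε hε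
      have h2 : ε * degrees a r ≤ 0 :=
        mul_nonpos_of_nonneg_of_nonpos (le_of_lt hε) (hne r h.symm)
      have h3 : degrees v r = 0 := h.symm
      linarith
    · have hc : Continuous fun ε : ℝ => degrees v r - ε * degrees a r := by fun_prop
      have := (hc.tendsto 0).eventually_const_lt (u := 0) (by simpa using h)
      exact (this.filter_mono nhdsWithin_le_nhds).mono fun _ => le_of_lt
  obtain ⟨ε, hε, hpos⟩ := (hev.and self_mem_nhdsWithin).exists
  have := hv.2 (ε • a) (smul_mem_coneGen (le_of_lt hpos) ha) hε
  exact ha0 ((smul_eq_zero.1 this).resolve_left (ne_of_gt hpos))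

/-! ### Reduced classes vanish -/

/-- Decompositions into elements of `curves` of the classes that are tested against a reduced
class. -/
def testTerms : Fin 7 → List (Fin 16 → ℤ)
  | 0 => [B6Z 0 1]
  | 1 => [A6Z 0]
  | 2 => [A63Z 0 1]
  | 3 => [A3Z 0 3 4, B6Z 3 4]
  | 4 => [A2Z 0 1 2 3 4, B6Z 2 4, B6Z 3 4]
  | 5 => [A2Z 3 4 0 1 2, A2Z 0 3 1 2 4, B6Z 1 2, B6Z 1 2]
  | 6 => [A2Z 1 2 0 3 4, A2Z 0 1 2 3 4, B6Z 0 3, B6Z 2 4, B6Z 3 4]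

/-- The classes that are tested against a reduced class. -/
def testClass (m : Fin 7) : Fin 16 → ℤ := (testTerms m).sum

lemma testTerms_subset : ∀ m, ∀ a ∈ testTerms m, a ∈ curves := by decide +kernel

lemma testClass_ne_zero : ∀ m, testClass m ≠ 0 := by decide +kernel

lemma toReal_testClass_mem (m : Fin 7) : toReal (testClass m) ∈ coneGen Aset := by
  rw [testClass, map_list_sum]
  refine List.sum_induction (· ∈ coneGen Aset) (fun _ _ => add_mem_coneGen)
    (zero_mem_coneGen _) fun x hx => ?_
  obtain ⟨a, ha, rfl⟩ := List.mem_map.1 hx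
  exact mem_coneGen_of_mem (toReal_mem_Aset (testTerms_subset m a ha))

/-- A set of divisors is spanning if a reduced class of degree zero on all of them vanishes. -/
def Spanning (N : List (Fin 40)) : Prop :=
  ∀ v, IsReduced v → (∀ r ∈ N, degrees v r = 0) → v = 0

lemma Spanning.map_swapDivisor {N : List (Fin 40)} (hN : Spanning N) (s : Fin 5) :
    Spanning (N.map (swapDivisor s)) := fun v hv h => by
  rw [← swap_swap s v, hN _ (hv.swap s) fun r hr => ?_, map_zero]
  rw [degrees_swap]
  exact h _ (List.mem_map_of_mem hr)

lemma Spanning.foldl_map_swapDivisor {N : List (Fin 40)} (hN : Spanning N)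
    (w : List (Fin 5)) : Spanning (w.foldl (fun N s => N.map (swapDivisor s)) N) := by
  induction w generalizing N with
  | nil => exact hN
  | cons s w ih => exact ih (hN.map_swapDivisor s)

/-- The first 16 rows of `divisors`; they form a basis of `ℤ ^ 16`. -/
def basisRows : List (Fin 40) := [0, 1, 2, 3, 4, 5, 6, 7, 8, 9, 10, 11, 12, 13, 14, 15]

lemma exists_basisRows_dual : ∀ k : Fin 16, ∀ j,
    (if k = 0 then ([15, 0, 1, 2, 5, 6, 9].map fun r => divisors r j).sum
      else divisors (Fin.ofNat 40 (k - 1 : ℕ)) j) = if k = j then 1 else 0 := by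
  decide +kernel

lemma spanning_basisRows : Spanning basisRows := fun v _ h => by
  have key (k : Fin 16) : ∃ l : List (Fin 40), (∀ r ∈ l, r ∈ basisRows) ∧
      ∀ j, (l.map fun r => divisors r j).sum = if k = j then 1 else 0 := by
    by_cases hk : k = 0
    · exact ⟨[15, 0, 1, 2, 5, 6, 9], by decide, fun j => by
        simpa only [hk, if_true] using exists_basisRows_dual 0 j⟩
    · exact ⟨[Fin.ofNat 40 (k - 1 : ℕ)], by revert k; decide, fun j => by
        simpa [hk] using exists_basisRows_dual k j⟩
  ext k
  obtain ⟨l, hl, hj⟩ := key k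
  have hsum : (l.map (degrees v)).sum = 0 :=
    List.sum_eq_zero fun x hx => by
      obtain ⟨r, hr, rfl⟩ := List.mem_map.1 hx
      exact h r (hl r hr)
  have hexp : (l.map (degrees v)).sum =
      ∑ j, (((l.map fun r => divisors r j).sum : ℤ) : ℝ) * v j := by
    clear hj hl hsum
    induction l with
    | nil => simp
    | cons r l ih => simp [ih, degrees_apply, add_mul, Finset.sum_add_distrib]
  simpa [hexp, hj] using hsum

/-- A justification that a class of degree zero on given divisors vanishes: an earlier spanning
set (by position), a word in the adjacent transpositions by which it is moved, and a linear
relation between divisors from which the remaining degrees are seen to be zero. -/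
structure Justification where
  target : ℕ
  word : List (Fin 5)
  relation : List (Fin 40 × ℤ)

/-- The relation is valid and its negative coefficients occur only at elements of `Z`. -/
def relationValid (Z : List (Fin 40)) (rel : List (Fin 40 × ℤ)) : Bool :=
  ((List.finRange 16).all fun k => (rel.map fun p => p.2 * divisors p.1 k).sum = 0) &&
    rel.all fun p => 0 ≤ p.2 || Z.contains p.1

/-- The justification is valid for classes of degree zero on `Z`. -/
def Justification.valid (known : List (List (Fin 40))) (Z : List (Fin 40))
    (J : Justification) : Bool :=
  relationValid Z J.relation &&
    match known[J.target]? with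
    | none => false
    | some N => (J.word.foldl (fun N s => N.map (swapDivisor s)) N).all fun r =>
        Z.contains r || J.relation.any fun p => p.1 = r && 0 < p.2

/-- Successive justifications are valid for `Z` enlarged by the successive elements of a list. -/
def allValid (known : List (List (Fin 40))) (Z : List (Fin 40)) :
    List (Fin 40) → List Justification → Bool
  | [], _ => true
  | _ :: _, [] => false
  | r :: rs, J :: Js => J.valid known (r :: Z) && allValid known Z rs Js

/-- One step of the case analysis: the set `zeros` is spanning, as one sees by testing against
`testClass move` and justifying each possible new zero. -/
structure Step where
  zeros : List (Fin 40)
  move : Fin 7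
  cases : List Justification

/-- The divisors on which a test class has positive degree. -/
def positiveRows (m : Fin 7) : List (Fin 40) :=
  (List.finRange 40).filter fun r => 0 < pair (divisorTerms r) (testClass m)

/-- The steps are valid, given the spanning sets `known`, and end with the empty spanning set. -/
def stepsValid : List (List (Fin 40)) → List Step → Bool
  | known, [] => known.contains []
  | known, S :: steps => allValid known S.zeros (positiveRows S.move) S.cases &&
      stepsValid (known ++ [S.zeros]) steps

lemma degrees_eq_zero_of_relationValid {Z : List (Fin 40)} {rel : List (Fin 40 × ℤ)}
    (hrel : relationValid Z rel) {v : Fin 16 → ℝ} (hv : 0 ≤ degrees v)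
    (hZ : ∀ r ∈ Z, degrees v r = 0) {p : Fin 40 × ℤ} (hp : p ∈ rel) (hpos : 0 < p.2) :
    degrees v p.1 = 0 := by
  simp only [relationValid, Bool.and_eq_true, List.all_eq_true, List.mem_finRange,
    decide_eq_true_eq, Bool.or_eq_true, List.contains_iff_mem, true_implies] at hrel
  obtain ⟨hsum, hneg⟩ := hrel
  have hexp : (rel.map fun p => (p.2 : ℝ) * degrees v p.1).sum =
      ∑ k, (((rel.map fun p => p.2 * divisors p.1 k).sum : ℤ) : ℝ) * v k := by
    clear hsum hneg hp
    induction rel with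
    | nil => simp
    | cons q rel ih =>
      rw [List.map_cons, List.sum_cons, ih, degrees_apply, Finset.mul_sum,
        ← Finset.sum_add_distrib]
      refine Finset.sum_congr rfl fun k _ => ?_
      simp only [List.map_cons, List.sum_cons, Int.cast_add, Int.cast_mul]
      ring
  simp only [hsum, Int.cast_zero, zero_mul, Finset.sum_const_zero] at hexp
  have hnn : ∀ x ∈ rel.map fun p => (p.2 : ℝ) * degrees v p.1, 0 ≤ x := fun x hx => by
    obtain ⟨q, hq, rfl⟩ := List.mem_map.1 hx
    rcases hneg q hq with h | h
    · exact mul_nonneg (Int.cast_nonneg h) (hv _)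
    · simp [hZ _ h]
  have h0 := List.all_zero_of_le_zero_le_of_sum_eq_zero hnn hexp (List.mem_map_of_mem hp)
  exact (mul_eq_zero.1 h0).resolve_left (Int.cast_ne_zero.2 hpos.ne')

lemma Justification.eq_zero_of_valid {known : List (List (Fin 40))}
    (hknown : ∀ N ∈ known, Spanning N) {Z : List (Fin 40)} {J : Justification}
    (hJ : J.valid known Z) {v : Fin 16 → ℝ} (hv : IsReduced v)
    (hZ : ∀ r ∈ Z, degrees v r = 0) : v = 0 := by
  rw [Justification.valid, Bool.and_eq_true] at hJ
  obtain ⟨hrel, hJ⟩ := hJ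
  split at hJ
  · exact absurd hJ (by simp)
  · rename_i N hN
    refine (hknown N (List.mem_of_getElem? hN)).foldl_map_swapDivisor J.word v hv fun r hr => ?_
    have := List.all_eq_true.1 hJ r hr
    simp only [Bool.or_eq_true, List.contains_iff_mem, List.any_eq_true, Bool.and_eq_true,
      decide_eq_true_eq] at this
    rcases this with h | ⟨p, hp, rfl, hpos⟩
    · exact hZ r h
    · exact degrees_eq_zero_of_relationValid hrel hv.1 hZ hp hpos

lemma exists_valid_of_allValid {known : List (List (Fin 40))} {Z rs : List (Fin 40)}
    {Js : List Justification} (h : allValid known Z rs Js) {r : Fin 40} (hr : r ∈ rs) :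
    ∃ J : Justification, J.valid known (r :: Z) := by
  induction rs generalizing Js with
  | nil => simp at hr
  | cons q rs ih =>
    cases Js with
    | nil => simp [allValid] at h
    | cons J Js =>
      rw [allValid, Bool.and_eq_true] at h
      rcases List.mem_cons.1 hr with rfl | hr
      · exact ⟨J, h.1⟩
      · exact ih h.2 hr

lemma Step.spanning {known : List (List (Fin 40))} (hknown : ∀ N ∈ known, Spanning N)
    {S : Step} (hS : allValid known S.zeros (positiveRows S.move) S.cases) :
    Spanning S.zeros := fun v hv h => by
  obtain ⟨r, hr0, hr⟩ := hv.exists_degrees_eq_zero (toReal_testClass_mem S.move) fun h0 =>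
    testClass_ne_zero S.move (funext fun k => by
      simpa [toReal_apply] using congrFun h0 k)
  rw [degrees_toReal, Int.cast_pos] at hr
  obtain ⟨J, hJ⟩ := exists_valid_of_allValid hS (r := r) (by simpa [positiveRows] using hr)
  exact J.eq_zero_of_valid hknown hJ hv (by simpa [hr0] using h)

lemma spanning_nil_of_stepsValid {known : List (List (Fin 40))}
    (hknown : ∀ N ∈ known, Spanning N) {steps : List Step} (h : stepsValid known steps) :
    Spanning [] := by
  induction steps generalizing known with
  | nil => exact hknown _ (List.contains_iff_mem.1 h)
  | cons S steps ih =>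
    rw [stepsValid, Bool.and_eq_true] at h
    refine ih (fun N hN => ?_) h.2
    rcases List.mem_append.1 hN with hN | hN
    · exact hknown N hN
    · rw [List.mem_singleton.1 hN]
      exact Step.spanning hknown h.1

/-- The case analysis showing that reduced classes vanish. -/
def caseAnalysis : List Step := [
  { zeros := [1, 30, 33], move := 5, cases := [
      ⟨0, [2, 1], [(0, 1), (1, -3), (2, 1), (3, 6), (4, 4), (5, -5), (6, 1), (7, 1), (8, 5),
        (9, 3), (10, 3), (11, 1), (12, 7), (13, 1), (14, 1), (18, 5), (20, 5), (22, 3), (23, 3),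
        (24, 2), (30, -4), (33, -5)]⟩,
      ⟨0, [2], [(0, 1), (1, -3), (2, 1), (3, 6), (4, 4), (5, 1), (6, -5), (7, 1), (8, 5), (9, 3),
        (10, 3), (11, 1), (12, 7), (13, 1), (14, 1), (16, 3), (18, 2), (20, 5), (22, 3), (24, 5),
        (30, -7), (33, -2)]⟩,
      ⟨0, [], [(0, 1), (2, 1), (3, 1), (4, 4), (5, 1), (6, 1), (7, -5), (8, 5), (9, 3), (10, 3),
        (11, 1), (12, 3), (13, 1), (14, 1), (15, 3), (17, 1), (19, 2), (20, 2), (23, 3), (24, 3),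
        (30, -4), (33, -3)]⟩,
      ⟨0, [], [(0, 4), (1, -3), (2, 1), (3, 6), (4, 1), (5, 1), (6, 1), (7, 1), (8, 5), (9, 3),
        (10, 3), (11, -5), (12, 7), (13, 1), (14, 1), (15, 3), (16, 3), (18, 2), (20, 5),
        (24, 5), (30, -4), (33, -5)]⟩,
      ⟨0, [], [(0, 4), (1, -3), (2, 1), (3, 6), (4, 1), (5, 1), (6, 1), (7, 1), (8, 5), (9, 3),
        (10, 3), (11, 1), (12, 7), (13, -5), (14, 1), (15, 3), (18, 5), (20, 5), (23, 3),
        (24, 2), (30, -7), (33, -2)]⟩,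
      ⟨0, [], [(0, 4), (2, 2), (3, 1), (4, 1), (5, 1), (6, 1), (7, 1), (8, 5), (9, 5), (10, 3),
        (11, 1), (12, 3), (13, 1), (14, -5), (15, 1), (16, 3), (18, 3), (19, 2), (20, 3),
        (22, 4), (30, -5), (33, -3)]⟩,
      ⟨0, [2, 1, 4], [(0, 3), (1, -2), (3, 3), (4, 3), (5, 1), (6, 1), (7, 1), (8, 3), (9, 1),
        (10, 1), (11, 1), (12, 3), (13, 1), (14, 1), (15, 2), (16, 2), (18, 3), (20, 3),
        (21, -3), (22, 2), (23, 2), (24, 3), (30, -4), (33, -3)]⟩,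
      ⟨0, [], [(0, 1), (2, 2), (3, 2), (4, 4), (5, 1), (6, 1), (7, 1), (8, 5), (9, 5), (10, 1),
        (11, 1), (12, 1), (13, 1), (14, 1), (15, 1), (16, 2), (18, 2), (19, 2), (20, 3), (22, 4),
        (23, 2), (24, 2), (25, -3), (30, -4), (33, -2)]⟩,
      ⟨0, [2, 3], [(0, 1), (2, 1), (3, 3), (4, 4), (5, 3), (6, 1), (7, 1), (8, 5), (9, 1),
        (10, 3), (11, 1), (12, 1), (13, 1), (14, 1), (15, 3), (17, 1), (18, 2), (20, 4), (22, 2),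
        (23, 3), (24, 3), (26, -4), (30, -4), (33, -1)]⟩,
      ⟨0, [], [(0, 1), (1, -1), (2, 1), (3, 4), (4, 4), (5, 1), (6, 1), (7, 1), (8, 5), (9, 1),
        (10, 1), (11, 1), (12, 5), (13, 1), (14, 1), (15, 2), (16, 2), (18, 1), (19, 1), (20, 4),
        (22, 2), (23, 2), (24, 4), (27, -3), (30, -3), (33, -3)]⟩,
      ⟨0, [], [(0, 2), (2, 1), (3, 3), (4, 2), (5, 1), (6, 1), (7, 1), (8, 1), (9, 5), (10, 3),
        (11, 1), (12, 1), (13, 1), (14, 1), (15, 1), (16, 3), (18, 2), (20, 4), (22, 4), (24, 2),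
        (28, -3), (30, -2), (33, -3)]⟩,
      ⟨0, [], [(0, 2), (1, -1), (2, 1), (3, 3), (4, 2), (5, 1), (6, 1), (7, 1), (8, 1), (9, 3),
        (10, 3), (11, 1), (12, 1), (13, 1), (14, 1), (15, 3), (18, 2), (19, 1), (20, 3), (23, 3),
        (24, 2), (29, -3), (30, -2), (33, -2)]⟩,
      ⟨0, [], [(0, 2), (2, 1), (3, 4), (4, 2), (5, 1), (6, 1), (7, 1), (8, 1), (9, 5), (10, 1),
        (11, 1), (12, 5), (13, 1), (14, 1), (15, 1), (16, 2), (18, 4), (20, 4), (22, 4), (23, 2),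
        (24, 1), (30, -4), (31, -3), (33, -2)]⟩,
      ⟨0, [2, 1, 0], [(0, 2), (2, 1), (3, 4), (4, 2), (5, 1), (6, 1), (7, 1), (8, 1), (9, 5),
        (10, 1), (11, 1), (12, 5), (13, 1), (14, 1), (15, 4), (16, 2), (19, 1), (20, 4), (21, 1),
        (23, 2), (24, 4), (30, -4), (32, -4), (33, -1)]⟩,
      ⟨0, [], [(0, 2), (2, 2), (3, 1), (4, 2), (5, 1), (6, 1), (7, 1), (8, 1), (9, 1), (10, 3),
        (11, 1), (12, 3), (13, 1), (14, 1), (15, 2), (18, 3), (19, 2), (20, 2), (22, 2), (23, 3),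
        (30, -3), (33, -1), (34, -3)]⟩,
      ⟨0, [], [(0, 2), (2, 2), (3, 1), (4, 2), (5, 1), (6, 1), (7, 1), (8, 1), (9, 1), (10, 3),
        (11, 1), (12, 3), (13, 1), (14, 1), (15, 2), (16, 3), (19, 2), (20, 2), (22, 2), (24, 3),
        (30, -3), (33, -1), (35, -3)]⟩,
      ⟨0, [], [(0, 4), (1, -1), (2, 1), (3, 4), (4, 1), (5, 1), (6, 1), (7, 1), (8, 5), (9, 1),
        (10, 1), (11, 1), (12, 5), (13, 1), (14, 1), (15, 2), (16, 2), (18, 4), (19, 1), (20, 4),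
        (22, 2), (23, 2), (24, 1), (30, -3), (33, -3), (37, -3)]⟩,
      ⟨0, [2, 3], [(0, 4), (2, 1), (3, 3), (4, 1), (5, 1), (6, 1), (7, 1), (8, 5), (9, 1),
        (10, 3), (11, 3), (12, 1), (13, 1), (14, 1), (15, 2), (16, 3), (17, 1), (18, 3), (20, 4),
        (22, 3), (24, 2), (30, -4), (33, -1), (38, -4)]⟩,
      ⟨0, [], [(0, 4), (2, 1), (3, 2), (4, 1), (5, 1), (6, 1), (7, 1), (8, 5), (9, 3), (10, 1),
        (11, 1), (12, 1), (13, 1), (14, 1), (15, 3), (16, 2), (17, 1), (18, 2), (19, 2), (20, 2),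
        (23, 2), (24, 2), (30, -3), (33, -2), (39, -3)]⟩] },
  { zeros := [38, 39], move := 4, cases := [
      ⟨1, [0, 1, 2, 4, 3], [(2, 1), (5, -1), (6, 1), (11, 1), (13, 1), (18, 1), (22, 1),
        (38, -1)]⟩,
      ⟨1, [0, 1, 2, 4, 3], [(1, 1), (10, 1), (11, 1), (12, -1), (13, 1), (16, 1), (22, 1),
        (38, -1)]⟩, ⟨1, [0, 1, 0, 2, 4, 3], []⟩, ⟨1, [0, 1, 0, 2, 4, 3, 2], []⟩,
      ⟨1, [0, 1, 2, 4, 3], []⟩, ⟨1, [0, 1, 2, 4, 3, 2], []⟩,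
      ⟨1, [0, 3, 2, 4, 3], [(2, 1), (6, 2), (18, 1), (22, 1), (25, -1), (38, -1), (39, 1)]⟩,
      ⟨1, [0, 3, 2, 4, 3, 2], [(3, 1), (7, 2), (18, 1), (23, 1), (26, -1), (38, 1), (39, -1)]⟩,
      ⟨1, [0, 1, 2, 4, 3], [(1, 1), (11, 2), (16, 1), (22, 1), (26, 1), (27, -1), (38, -1)]⟩,
      ⟨1, [3, 2, 4, 3], [(2, 1), (9, 2), (19, 1), (21, 1), (28, -1), (38, 1), (39, -1)]⟩,
      ⟨1, [3, 2, 4, 3, 2], [(3, 1), (10, 2), (20, 1), (21, 1), (29, -1), (38, -1), (39, 1)]⟩,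
      ⟨1, [0, 1, 2, 4, 3], [(2, 1), (11, 2), (18, 1), (22, 1), (30, -1), (33, 1), (38, -1)]⟩,
      ⟨1, [0, 1, 2, 4, 3], [(1, 1), (13, 2), (16, 1), (22, 1), (28, 1), (31, -1), (38, -1)]⟩,
      ⟨1, [2, 3, 2, 4, 3, 2], [(0, 1), (6, 2), (15, 1), (20, 1), (32, -1), (38, -1), (39, 1)]⟩,
      ⟨1, [0, 1, 2, 4, 3, 2], [(1, 1), (9, 2), (15, 1), (23, 1), (33, -1), (38, 1), (39, -1)]⟩,
      ⟨1, [0, 1, 2, 4, 3], [(2, 1), (13, 2), (18, 1), (22, 1), (34, -1), (35, 1), (38, -1)]⟩,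
      ⟨1, [2, 3, 2, 4, 3], [(0, 1), (7, 2), (16, 1), (19, 1), (35, -1), (38, 1), (39, -1)]⟩,
      ⟨1, [0, 1, 2, 4, 3], [(1, 1), (10, 2), (16, 1), (22, 1), (36, -1), (38, -1), (39, 1)]⟩,
      ⟨1, [0, 1, 2, 4, 3], [(1, 1), (2, 1), (11, 2), (13, 2), (16, 1), (18, 1), (22, 2),
        (37, -1), (38, -1)]⟩] },
  { zeros := [0, 8, 32], move := 2, cases := [
      ⟨1, [0], [(5, -1), (8, -1), (9, 1), (13, 1), (27, 1), (32, -1)]⟩,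
      ⟨1, [0], [(1, 1), (8, -2), (9, 2), (13, 2), (15, 1), (16, 1), (18, -1), (24, 1), (27, 1),
        (32, -2)]⟩,
      ⟨2, [1, 0, 3, 2, 1, 0, 4, 3], [(0, -1), (3, 1), (8, -2), (12, 2), (19, -1), (24, 1),
        (32, -1), (39, 1)]⟩,
      ⟨2, [3, 2], [(0, -1), (1, 1), (8, -2), (11, 2), (20, -1), (23, 1), (32, -1), (33, 1)]⟩,
      ⟨1, [0], [(1, 1), (9, 2), (17, 1), (21, 1), (25, -1), (27, 1), (32, -1)]⟩,
      ⟨1, [0], [(4, 1), (13, 2), (17, 1), (24, 1), (26, -1), (27, 1), (32, -1)]⟩, ⟨1, [0], []⟩,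
      ⟨1, [0], [(8, -2), (9, 2), (27, 1), (28, -1), (32, -1), (38, 1)]⟩,
      ⟨2, [3, 2, 1, 0, 4, 3], []⟩,
      ⟨1, [0], [(0, 1), (9, 2), (15, 1), (20, 1), (27, 1), (30, -1), (32, -1)]⟩,
      ⟨2, [1, 0, 3, 2], []⟩, ⟨1, [0], [(8, -2), (13, 2), (27, 1), (32, -1), (34, -1), (36, 1)]⟩,
      ⟨1, [0], [(0, 1), (13, 2), (16, 1), (19, 1), (27, 1), (32, -1), (37, -1)]⟩] },
  { zeros := [0, 6, 7, 9, 13, 15, 16, 32], move := 2, cases := [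
      ⟨3, [0, 1, 3, 4], []⟩,
      ⟨3, [0, 1, 0, 2, 1, 0, 4], [(0, -1), (4, 1), (6, -1), (7, -1), (13, 1), (14, 1), (18, -1),
        (24, 1)]⟩,
      ⟨3, [0, 1, 0, 2, 1, 0, 4], [(0, -1), (6, -1), (7, -1), (13, -1), (14, 1), (16, -1),
        (19, -1), (32, 1)]⟩,
      ⟨3, [1, 0, 3, 2, 1, 0, 4], [(0, -1), (6, -1), (7, -1), (9, -1), (10, 1), (15, -1),
        (20, -1), (32, 1)]⟩, ⟨3, [0, 2, 1, 4], []⟩, ⟨3, [1, 0, 2, 1, 0, 3, 2, 1, 0, 4], []⟩,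
      ⟨1, [0], []⟩, ⟨3, [1, 2, 3], []⟩, ⟨1, [1, 3, 4], []⟩, ⟨3, [1, 3], []⟩,
      ⟨3, [1, 2, 1, 3], []⟩, ⟨3, [1, 2, 1, 3, 2], []⟩, ⟨3, [2, 1, 3], []⟩] },
  { zeros := [1, 3, 4, 5, 7, 8, 9, 14, 25], move := 0, cases := [
      ⟨4, [0, 2, 1, 4], [(3, 1), (7, 2), (15, -1), (16, 1), (18, 1), (22, 1), (25, -1)]⟩,
      ⟨4, [0, 2, 1, 4], []⟩, ⟨4, [0, 1, 4, 3, 2], []⟩, ⟨3, [1, 3, 2, 1, 0], []⟩,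
      ⟨3, [0, 1, 2, 1], []⟩, ⟨3, [0, 3, 2], []⟩, ⟨1, [1, 0, 3, 2], []⟩, ⟨3, [0, 2, 3, 2], []⟩,
      ⟨1, [1, 0, 2, 3, 2], []⟩] },
  { zeros := [3, 6, 7, 9, 12, 13, 15, 32], move := 2, cases := [
      ⟨3, [1, 0, 2, 1, 0, 3, 2, 4], []⟩,
      ⟨4, [0, 2, 3, 2, 4, 3, 2], [(1, 1), (9, 2), (15, 1), (18, -1), (20, 1), (21, 1), (32, -1)]⟩,
      ⟨5, [1, 2, 1, 3, 4, 3], []⟩, ⟨4, [0, 2, 3, 2, 4, 3, 2], []⟩, ⟨3, [0, 1, 0, 3, 2], []⟩,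
      ⟨3, [1, 0, 2, 1, 3, 2], []⟩, ⟨2, [3, 2, 1, 4], []⟩, ⟨3, [0, 1, 3, 2], []⟩,
      ⟨2, [3, 2, 1, 0, 4, 3], []⟩, ⟨3, [1, 0, 2, 1, 3, 2, 1, 0], []⟩, ⟨2, [1, 0, 3, 2], []⟩,
      ⟨3, [0, 1, 3, 2, 1, 4], []⟩, ⟨3, [0, 2, 1, 3, 2, 1, 0], []⟩] },
  { zeros := [2, 5, 6, 7, 8, 9, 25], move := 0, cases := [
      ⟨6, [1, 0, 2], [(2, -1), (3, 1), (6, -1), (7, 1), (9, -1), (10, 1), (15, -1), (16, 1)]⟩,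
      ⟨6, [1, 0, 2], []⟩, ⟨6, [1, 0, 2, 3], []⟩,
      ⟨1, [1, 0], [(5, -1), (8, -1), (9, 1), (13, 1), (27, 1), (32, -1)]⟩,
      ⟨3, [3], [(0, 1), (2, -1), (4, 1), (8, 2), (17, 1), (20, 1), (33, -1)]⟩,
      ⟨3, [1, 2, 1, 0, 3, 2, 1], []⟩, ⟨2, [3, 2, 1, 4, 3, 2], []⟩, ⟨3, [2, 1, 0, 3, 2, 1], []⟩,
      ⟨3, [2, 1, 0, 3, 2, 1, 0], []⟩] },
  { zeros := [5, 7, 8, 9, 14, 25], move := 0, cases := [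
      ⟨7, [2, 1, 0, 4, 3, 2], [(3, 1), (7, 2), (15, -1), (16, 1), (18, 1), (22, 1), (25, -1)]⟩,
      ⟨7, [2, 1, 0, 4, 3, 2], []⟩, ⟨7, [1, 2, 1, 0, 4, 3, 2], []⟩,
      ⟨2, [1, 3, 4], [(5, -1), (7, 1), (11, 1), (14, -1), (31, 1), (32, -1)]⟩,
      ⟨2, [1, 3, 4], [(5, -1), (8, 1), (10, 1), (14, -1), (31, 1), (33, -1)]⟩,
      ⟨2, [3], [(6, 1), (8, -1), (9, -1), (11, 1), (35, -1), (36, 1)]⟩,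
      ⟨2, [3, 2, 1, 4, 3, 2], []⟩,
      ⟨2, [], [(6, 1), (7, -1), (9, -1), (10, 1), (38, -1), (39, 1)]⟩,
      ⟨2, [1, 3, 2, 1, 4, 3, 2], []⟩] },
  { zeros := [9, 10, 11, 14, 28], move := 1, cases := [
      ⟨8, [2, 3, 4, 3, 2], []⟩, ⟨8, [1, 0], []⟩,
      ⟨8, [1, 0], [(2, 1), (6, 1), (7, -1), (9, 1), (10, 1), (19, 1), (21, 1), (28, -1)]⟩,
      ⟨8, [1, 0], [(2, 1), (6, 1), (8, -1), (9, 1), (11, 1), (18, 1), (22, 1), (28, -1)]⟩,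
      ⟨2, [3, 4], []⟩, ⟨2, [3, 4], [(9, -1), (10, 1), (13, 1), (14, -1), (25, 1), (26, -1)]⟩,
      ⟨2, [3, 4], [(9, -1), (11, 1), (12, 1), (14, -1), (25, 1), (27, -1)]⟩] },
  { zeros := [8, 9, 10, 30], move := 5, cases := [
      ⟨9, [0, 2, 3, 4], []⟩,
      ⟨9, [0, 2, 3, 4], [(3, 1), (5, 1), (6, -1), (10, 1), (12, 1), (16, 1), (24, 1), (30, -1)]⟩,
      ⟨9, [0, 2, 3, 4], [(2, 1), (5, 1), (7, -1), (9, 1), (12, 1), (15, 1), (24, 1), (30, -1)]⟩,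
      ⟨9, [1, 2, 1, 3, 2, 4, 3, 2, 1], []⟩,
      ⟨9, [0, 2, 3, 4], [(0, 1), (5, 1), (8, 1), (9, 1), (13, -1), (15, 1), (20, 1), (30, -1)]⟩,
      ⟨9, [0, 2, 3, 4], [(0, 1), (5, 1), (8, 1), (10, 1), (14, -1), (16, 1), (19, 1), (30, -1)]⟩,
      ⟨9, [0, 2, 3, 4], [(0, 1), (5, 2), (15, 1), (16, 1), (21, -1), (24, 1), (30, -1)]⟩,
      ⟨2, [3, 4], [(4, 1), (8, 2), (19, 1), (23, 1), (25, -1), (28, 1), (30, -1)]⟩,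
      ⟨2, [3, 2, 4], [(4, 1), (8, 2), (20, 1), (22, 1), (26, -1), (29, 1), (30, -1)]⟩,
      ⟨2, [3, 2, 4, 3], []⟩, ⟨2, [1, 3, 2, 1], []⟩, ⟨2, [3, 2, 1], []⟩,
      ⟨2, [1, 3, 2], [(5, 1), (8, -1), (10, -1), (14, 1), (31, -1), (33, 1)]⟩,
      ⟨2, [3, 2], [(7, 1), (8, -1), (10, -1), (11, 1), (32, -1), (33, 1)]⟩,
      ⟨2, [1, 3], [(5, 1), (8, -1), (9, -1), (13, 1), (34, -1), (36, 1)]⟩,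
      ⟨2, [3], [(6, 1), (8, -1), (9, -1), (11, 1), (35, -1), (36, 1)]⟩,
      ⟨2, [1, 0, 3, 2, 4, 3], []⟩,
      ⟨2, [1, 0], [(3, 1), (10, 2), (16, 1), (24, 1), (30, -1), (37, 1), (38, -1)]⟩,
      ⟨2, [1], [(2, 1), (9, 2), (15, 1), (24, 1), (30, -1), (37, 1), (39, -1)]⟩] },
  { zeros := [9, 14, 28], move := 1, cases := [
      ⟨10, [0, 1, 0, 2], []⟩, ⟨10, [0, 1, 0, 3, 4, 3, 2, 1, 0], []⟩,
      ⟨10, [0, 1, 0, 2], [(4, 1), (5, 1), (7, -1), (11, 1), (14, 1), (17, 1), (24, 1), (28, -1)]⟩,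
      ⟨10, [0, 1, 0, 2], [(3, 1), (5, 1), (8, -1), (10, 1), (14, 1), (16, 1), (24, 1), (28, -1)]⟩,
      ⟨2, [3, 4], []⟩, ⟨2, [3, 4], [(9, -1), (10, 1), (13, 1), (14, -1), (25, 1), (26, -1)]⟩,
      ⟨2, [3, 4], [(9, -1), (11, 1), (12, 1), (14, -1), (25, 1), (27, -1)]⟩] },
  { zeros := [10, 28], move := 1, cases := [
      ⟨11, [1, 2, 1, 4, 3], []⟩, ⟨11, [0, 1, 2, 1, 0, 3, 2], []⟩,
      ⟨11, [1, 2, 1, 4, 3], [(4, 1), (5, 1), (7, -1), (11, 1), (14, 1), (17, 1), (24, 1),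
        (28, -1)]⟩,
      ⟨11, [1, 2, 1, 4, 3], [(3, 1), (5, 1), (8, -1), (10, 1), (14, 1), (16, 1), (24, 1),
        (28, -1)]⟩, ⟨2, [3, 4], []⟩,
      ⟨2, [3, 4], [(3, 1), (10, 2), (20, 1), (21, 1), (25, 1), (26, -1), (28, -1)]⟩,
      ⟨2, [3, 4], [(4, 1), (11, 2), (20, 1), (22, 1), (25, 1), (27, -1), (28, -1)]⟩] },
  { zeros := [28], move := 1, cases := [
      ⟨12, [0, 2, 1, 0, 3, 2], []⟩, ⟨12, [1, 2, 1, 4], []⟩,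
      ⟨12, [], [(2, 1), (6, 1), (7, -1), (9, 1), (10, 1), (19, 1), (21, 1), (28, -1)]⟩,
      ⟨12, [], [(3, 1), (5, 1), (8, -1), (10, 1), (14, 1), (16, 1), (24, 1), (28, -1)]⟩,
      ⟨2, [3, 4], []⟩, ⟨12, [], [(3, 1), (10, 2), (20, 1), (21, 1), (25, 1), (26, -1), (28, -1)]⟩,
      ⟨12, [3], [(4, 1), (11, 2), (20, 1), (22, 1), (25, 1), (27, -1), (28, -1)]⟩] },
  { zeros := [0, 1, 8, 11, 17, 21], move := 2, cases := [
      ⟨13, [0], [(0, -1), (1, -1), (2, 1), (5, -2), (8, -2), (13, 2), (17, -2), (21, -1),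
        (22, 1), (25, 1)]⟩,
      ⟨13, [4, 3], [(0, -1), (1, -1), (8, -2), (11, -2), (17, -2), (18, -1), (21, -1), (38, 1),
        (39, 1)]⟩,
      ⟨13, [0, 4, 3], [(0, -1), (8, -2), (17, -1), (19, -1), (21, -1), (22, 1), (39, 1)]⟩,
      ⟨13, [4, 3], [(0, -1), (8, -2), (17, -1), (20, -1), (21, -1), (23, 1), (38, 1)]⟩,
      ⟨13, [0], []⟩, ⟨13, [0, 2], []⟩, ⟨13, [0, 2, 1], []⟩, ⟨13, [], []⟩, ⟨13, [2], []⟩,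
      ⟨13, [2, 3], []⟩, ⟨13, [1], []⟩, ⟨13, [1, 2], []⟩, ⟨13, [1, 2, 3], []⟩] },
  { zeros := [1, 7, 8, 9, 16, 17, 21, 22], move := 2, cases := [
      ⟨14, [1, 3, 4], []⟩, ⟨14, [1, 0, 2, 1, 3, 2, 1, 4, 3, 2, 1], []⟩,
      ⟨14, [1, 0, 2, 3, 2, 1, 4, 3, 2, 1], []⟩,
      ⟨13, [1], [(1, -1), (9, -2), (20, -1), (21, -1), (22, -1), (24, 1), (31, 1)]⟩,
      ⟨13, [0], []⟩, ⟨13, [0, 2], []⟩, ⟨13, [0, 2, 1], []⟩, ⟨13, [], []⟩, ⟨13, [2], []⟩,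
      ⟨13, [2, 3], []⟩, ⟨13, [1], []⟩, ⟨13, [1, 2], []⟩, ⟨13, [1, 2, 3], []⟩] },
  { zeros := [0, 1, 2, 9, 11, 17, 18, 21], move := 1, cases := [
      ⟨15, [1, 0, 4, 3, 2], [(1, -1), (3, 1), (5, -1), (7, 1), (11, -1), (14, 1), (17, -1),
        (20, 1)]⟩, ⟨14, [0, 1, 0, 2, 3, 2, 1, 0, 4, 3, 2], []⟩, ⟨15, [1, 0, 4, 3, 2], []⟩,
      ⟨14, [], []⟩, ⟨13, [0], []⟩, ⟨13, [0, 2], []⟩, ⟨13, [0, 2, 1], []⟩] },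
  { zeros := [0, 1, 3, 7, 10, 15, 17, 20, 21], move := 6, cases := [
      ⟨14, [0, 1, 3, 2, 4], []⟩, ⟨14, [1, 0, 2, 3, 2, 1, 4, 3], []⟩,
      ⟨14, [1, 0, 2, 1, 3, 2, 1, 0, 4, 3], []⟩, ⟨16, [1, 0, 3, 2], []⟩, ⟨16, [1, 2], []⟩,
      ⟨13, [2], [(2, 1), (3, -2), (6, 2), (7, -2), (10, -2), (15, 1), (16, -1), (20, -1),
        (21, -1), (29, 1)]⟩, ⟨14, [0, 3, 2, 4], []⟩, ⟨16, [1, 0, 2, 1, 3, 2, 1, 0, 4, 3], []⟩,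
      ⟨16, [1, 0, 2, 3, 2, 1, 4, 3], []⟩, ⟨14, [3, 4, 3, 2], []⟩, ⟨13, [0], []⟩, ⟨13, [0, 2], []⟩,
      ⟨13, [0, 2, 1], []⟩, ⟨13, [], []⟩, ⟨13, [2], []⟩, ⟨13, [2, 3], []⟩, ⟨13, [1], []⟩,
      ⟨13, [2, 1], []⟩, ⟨3, [3], []⟩, ⟨13, [1, 2], []⟩, ⟨13, [4], []⟩, ⟨13, [0, 4], []⟩,
      ⟨13, [1, 2, 3], []⟩, ⟨13, [4, 3], []⟩, ⟨13, [0, 4, 3], []⟩] },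
  { zeros := [1, 2, 7, 10, 16, 17, 21, 22], move := 2, cases := [
      ⟨16, [1, 3, 4], [(1, -1), (2, 1), (5, -1), (6, 1), (10, -1), (12, 1), (16, -1), (18, 1)]⟩,
      ⟨17, [0, 2, 4], []⟩, ⟨14, [0, 4, 3], []⟩, ⟨16, [1, 0, 3, 2, 1, 0, 4, 3, 2], []⟩,
      ⟨13, [0], []⟩, ⟨13, [0, 2], []⟩, ⟨13, [0, 2, 1], []⟩, ⟨13, [], []⟩, ⟨13, [2], []⟩,
      ⟨13, [2, 3], []⟩, ⟨13, [1], []⟩, ⟨13, [1, 2], []⟩, ⟨13, [1, 2, 3], []⟩] },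
  { zeros := [0, 1, 11, 15, 17, 18, 21], move := 1, cases := [
      ⟨13, [], [(0, -1), (1, -1), (2, 1), (5, -2), (11, -2), (13, 2), (17, -2), (18, -1),
        (19, 1), (28, 1)]⟩, ⟨16, [2, 4], []⟩, ⟨18, [0, 1, 2, 1, 0, 3, 2, 1, 4, 3], []⟩,
      ⟨14, [], []⟩, ⟨13, [0], []⟩, ⟨13, [0, 2], []⟩, ⟨13, [0, 2, 1], []⟩] },
  { zeros := [1, 9, 16, 17, 21, 22], move := 2, cases := [
      ⟨14, [1, 3, 4], []⟩, ⟨19, [0, 2, 1, 3, 4, 3], []⟩, ⟨19, [0, 2, 1, 3, 4], []⟩,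
      ⟨13, [1], [(1, -1), (9, -2), (20, -1), (21, -1), (22, -1), (24, 1), (31, 1)]⟩,
      ⟨13, [0], []⟩, ⟨13, [0, 2], []⟩, ⟨13, [0, 2, 1], []⟩, ⟨13, [], []⟩, ⟨13, [2], []⟩,
      ⟨13, [2, 3], []⟩, ⟨13, [1], []⟩, ⟨13, [1, 2], []⟩, ⟨13, [1, 2, 3], []⟩] },
  { zeros := [0, 1, 8, 17, 21], move := 2, cases := [
      ⟨13, [0], [(0, -1), (1, -1), (2, 1), (5, -2), (8, -2), (13, 2), (17, -2), (21, -1),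
        (22, 1), (25, 1)]⟩, ⟨20, [1, 4, 3], []⟩,
      ⟨13, [0, 4, 3], [(0, -1), (8, -2), (17, -1), (19, -1), (21, -1), (22, 1), (39, 1)]⟩,
      ⟨13, [4, 3], [(0, -1), (8, -2), (17, -1), (20, -1), (21, -1), (23, 1), (38, 1)]⟩,
      ⟨13, [0], []⟩, ⟨13, [0, 2], []⟩, ⟨13, [0, 2, 1], []⟩, ⟨13, [], []⟩, ⟨13, [2], []⟩,
      ⟨13, [2, 3], []⟩, ⟨13, [1], []⟩, ⟨13, [1, 2], []⟩, ⟨13, [1, 2, 3], []⟩] },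
  { zeros := [1, 5, 15, 16, 17], move := 3, cases := [
      ⟨13, [1], [(0, -1), (1, -1), (2, 1), (5, -2), (16, -1), (17, -1), (31, 1)]⟩,
      ⟨21, [0, 1, 3, 4], []⟩, ⟨21, [0, 1, 3, 4, 3], []⟩, ⟨21, [0, 1, 3, 4, 3, 2], []⟩,
      ⟨13, [0], [(1, -1), (5, -2), (16, -1), (17, -1), (20, 1), (24, -1), (25, 1)]⟩,
      ⟨13, [0], []⟩, ⟨13, [0, 2], []⟩, ⟨13, [0, 2, 1], []⟩, ⟨13, [], []⟩, ⟨13, [2], []⟩,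
      ⟨13, [2, 3], []⟩, ⟨13, [1], []⟩, ⟨13, [2, 1], []⟩, ⟨13, [0, 2, 4], []⟩, ⟨13, [1, 2], []⟩,
      ⟨13, [4], []⟩, ⟨13, [0, 4], []⟩, ⟨13, [1, 2, 3], []⟩, ⟨13, [4, 3], []⟩,
      ⟨13, [0, 4, 3], []⟩] },
  { zeros := [0, 6, 18, 19], move := 0, cases := [
      ⟨22, [0, 1], []⟩, ⟨21, [1, 0, 3, 4], []⟩, ⟨21, [1, 0, 3, 4, 3], []⟩, ⟨13, [2, 1], []⟩,
      ⟨13, [0, 2, 4], []⟩, ⟨13, [4], []⟩, ⟨13, [0, 4], []⟩, ⟨13, [4, 3], []⟩,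
      ⟨13, [0, 4, 3], []⟩] },
  { zeros := [0, 8, 11, 17, 18], move := 4, cases := [
      ⟨23, [2, 1, 0, 3, 4], [(0, -1), (3, 1), (5, -1), (8, -1), (10, 1), (14, 1), (17, -1),
        (23, 1)]⟩,
      ⟨23, [2, 1, 3], [(9, 1), (11, -1), (12, -1), (14, 1), (15, 1), (17, -1), (18, -1),
        (20, 1)]⟩, ⟨23, [2, 1, 3, 2], []⟩, ⟨23, [2, 1, 3], []⟩, ⟨23, [2, 1, 0, 3, 2, 4], []⟩,
      ⟨23, [2, 1, 0, 3, 4], []⟩, ⟨13, [0], []⟩, ⟨13, [0, 2], []⟩, ⟨13, [0, 2, 1], []⟩,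
      ⟨13, [], []⟩, ⟨13, [2], []⟩, ⟨13, [2, 3], []⟩, ⟨13, [1], []⟩, ⟨3, [], []⟩,
      ⟨13, [0, 2, 4], []⟩, ⟨13, [1, 2], []⟩, ⟨13, [4], []⟩, ⟨13, [0, 4], []⟩,
      ⟨13, [1, 2, 3], []⟩] },
  { zeros := [0, 11, 17, 18], move := 1, cases := [
      ⟨24, [1, 2, 3, 2, 1], []⟩, ⟨24, [1, 0, 2, 3, 2, 1, 0, 4, 3, 2], []⟩,
      ⟨24, [1, 0, 2, 3, 2, 1, 0, 4, 3], []⟩, ⟨24, [], []⟩, ⟨13, [0], []⟩, ⟨13, [0, 2], []⟩,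
      ⟨13, [0, 2, 1], []⟩] },
  { zeros := [0, 6, 15, 16], move := 2, cases := [
      ⟨23, [1, 2, 3], []⟩, ⟨23, [1, 2, 1, 3], []⟩, ⟨23, [1, 2, 1], []⟩, ⟨25, [0, 4, 3, 2], []⟩,
      ⟨13, [0], []⟩, ⟨13, [0, 2], []⟩, ⟨13, [0, 2, 1], []⟩, ⟨13, [], []⟩, ⟨13, [2], []⟩,
      ⟨13, [2, 3], []⟩, ⟨13, [1], []⟩, ⟨13, [1, 2], []⟩, ⟨13, [1, 2, 3], []⟩] },
  { zeros := [0, 6, 18], move := 0, cases := [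
      ⟨23, [1, 2, 1, 3], []⟩, ⟨26, [1, 2, 1], []⟩, ⟨25, [0, 1, 4, 3, 2], []⟩, ⟨13, [2, 1], []⟩,
      ⟨13, [0, 2, 4], []⟩, ⟨13, [4], []⟩, ⟨13, [0, 4], []⟩, ⟨13, [4, 3], []⟩,
      ⟨13, [0, 4, 3], []⟩] },
  { zeros := [0, 5], move := 0, cases := [
      ⟨27, [1, 2], []⟩, ⟨27, [1], []⟩, ⟨27, [1, 3], []⟩, ⟨13, [2, 1], []⟩, ⟨13, [0, 2, 4], []⟩,
      ⟨13, [4], []⟩, ⟨13, [0, 4], []⟩, ⟨13, [4, 3], []⟩, ⟨13, [0, 4, 3], []⟩] },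
  { zeros := [5], move := 0, cases := [
      ⟨28, [0, 1, 0, 2, 1, 4], []⟩, ⟨28, [1, 0, 2, 1, 4], []⟩, ⟨28, [1, 0, 2, 1, 4, 3], []⟩,
      ⟨13, [2, 1], []⟩, ⟨13, [0, 2, 4], []⟩, ⟨13, [4], []⟩, ⟨13, [0, 4], []⟩, ⟨13, [4, 3], []⟩,
      ⟨13, [0, 4, 3], []⟩] },
  { zeros := [], move := 1, cases := [
      ⟨29, [], []⟩, ⟨29, [1], []⟩, ⟨29, [1, 2], []⟩, ⟨29, [1, 2, 3], []⟩, ⟨13, [0], []⟩,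
      ⟨13, [0, 2], []⟩, ⟨13, [0, 2, 1], []⟩] }]

lemma stepsValid_caseAnalysis : stepsValid [basisRows] caseAnalysis = true := by
  decide +kernel

lemma IsReduced.eq_zero {v : Fin 16 → ℝ} (hv : IsReduced v) : v = 0 :=
  spanning_nil_of_stepsValid (by simpa using spanning_basisRows) stepsValid_caseAnalysis v hv
    (by simp)

end EffectiveCone

theorem gammaDual_subset_coneA :
    ∀ v : Fin 16 → ℝ, (∀ gv ∈ Gamma, 0 ≤ ip gv v) → v ∈ coneGen Aset := by
  intro v hv
  obtain ⟨a, ha, hred⟩ := EffectiveCone.exists_isReduced (v := v) fun r =>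
    hv _ (EffectiveCone.toReal_divisors_mem r)
  rwa [sub_eq_zero.1 hred.eq_zero]
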